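/- arXiv:2205.14602 — 3 statements merged into one kernel-verified Lean document; each statement's English description precedes it below -/
import Mathlib

section
/- Let 0 < q < ∞ and 1 < p < ∞, let T be a monotone quasilinear operator on M⁺(0,∞), let w be a weight on (0,∞), and let v be a weight on (0,∞) such that ∫₀^x v(t)^{1-p'} dt < ∞ for every x ∈ (0,∞). Then there exists a constant C > 0 such that ‖T(x ↦ ∫₀^x h(t) dt)‖_{q,w,(0,∞)} ≤ C ‖h‖_{p,v,(0,∞)} for all h ∈ M⁺(0,∞) if and only if there exists a constant C' > 0 such that ‖(T(x ↦ (∫₀^x h(t) dt)^{1/p}))^p‖_{q/p,w,(0,∞)} ≤ C' ‖h‖_{1,Φ^{1-2p},(0,∞)} for all h ∈ M⁺(0,∞), where Φ(x) := (∫₀^x v(t)^{1-p'} dt)^{1/(p'+1)}. -/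
open MeasureTheory Set ENNReal NNReal

noncomputable section

/-- Lebesgue measure restricted to `(0, ∞)`. -/
def mu0 : Measure ℝ := volume.restrict (Ioi (0 : ℝ))

/-- A weight on `(0, ∞)`: a measurable function that is positive (and finite) a.e. on `(0, ∞)`. -/
def IsWeight (v : ℝ → ℝ≥0∞) : Prop :=
  Measurable v ∧ ∀ᵐ x ∂mu0, 0 < v x ∧ v x < ∞

/-- The weighted Lebesgue functional `‖f‖_{p,w,(0,∞)}`. -/
def wnorm (p : ℝ) (w f : ℝ → ℝ≥0∞) : ℝ≥0∞ :=
  (∫⁻ x in Ioi (0 : ℝ), f x ^ p * w x) ^ (1 / p)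

/-- A monotone quasilinear operator on `M⁺(0,∞)`: positively homogeneous, a.e. monotone
(up to a multiplicative constant) and a.e. subadditive (up to a multiplicative constant). -/
structure IsMQL (T : (ℝ → ℝ≥0∞) → ℝ → ℝ≥0∞) : Prop where
  measurable_map : ∀ f : ℝ → ℝ≥0∞, Measurable f → Measurable (T f)
  homog : ∀ (c : ℝ≥0) (f : ℝ → ℝ≥0∞), Measurable f →
    T (fun x => (c : ℝ≥0∞) * f x) = fun x => (c : ℝ≥0∞) * T f x
  mono : ∃ C : ℝ≥0, 0 < C ∧ ∀ f g : ℝ → ℝ≥0∞, Measurable f → Measurable g →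
    (∀ᵐ x ∂mu0, f x ≤ g x) → ∀ᵐ x ∂mu0, T f x ≤ (C : ℝ≥0∞) * T g x
  subadd : ∃ C : ℝ≥0, 0 < C ∧ ∀ f g : ℝ → ℝ≥0∞, Measurable f → Measurable g →
    ∀ᵐ x ∂mu0, T (fun y => f y + g y) x ≤ (C : ℝ≥0∞) * (T f x + T g x)

/-- `Φ(x) = (∫₀^x v(t)^(1-p') dt)^(1/(p'+1))`, where `p' = p/(p-1)`. -/
def Phi (p : ℝ) (v : ℝ → ℝ≥0∞) (x : ℝ) : ℝ≥0∞ :=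
  (∫⁻ t in Ioc (0 : ℝ) x, v t ^ (1 - p / (p - 1))) ^ (1 / (p / (p - 1) + 1))

/-- The primitive `x ↦ ∫₀^x σ` of a nonnegative function. -/
def prim (σ : ℝ → ℝ≥0∞) (x : ℝ) : ℝ≥0∞ := ∫⁻ t in Ioc (0 : ℝ) x, σ t

theorem prim_monotone (σ : ℝ → ℝ≥0∞) : Monotone (prim σ) := fun _ _ h =>
  lintegral_mono_set (Ioc_subset_Ioc_right h)

theorem measurable_prim (σ : ℝ → ℝ≥0∞) : Measurable (prim σ) := (prim_monotone σ).measurable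

theorem prim_of_nonpos (σ : ℝ → ℝ≥0∞) {x : ℝ} (hx : x ≤ 0) : prim σ x = 0 := by
  simp [prim, Ioc_eq_empty_of_le hx]

theorem prim_add (σ : ℝ → ℝ≥0∞) {s t : ℝ} (hs : 0 ≤ s) (hst : s ≤ t) :
    prim σ s + ∫⁻ u in Ioc s t, σ u = prim σ t := by
  rw [prim, prim, ← lintegral_union measurableSet_Ioc (Ioc_disjoint_Ioc_of_le le_rfl),
    Ioc_union_Ioc_eq_Ioc hs hst]

theorem lintegral_Ioc_pos {σ : ℝ → ℝ≥0∞} (hσ : Measurable σ) (hpos : ∀ᵐ x ∂mu0, 0 < σ x)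
    {s t : ℝ} (hs : 0 ≤ s) (hst : s < t) : 0 < ∫⁻ u in Ioc s t, σ u := by
  rw [lintegral_pos_iff_support hσ]
  have h : ∀ᵐ x ∂(volume.restrict (Ioc s t)), x ∈ Function.support σ := by
    refine (ae_restrict_of_ae_restrict_of_subset (fun x hx => hs.trans_lt hx.1) hpos).mono ?_
    exact fun x hx => hx.ne'
  rw [measure_eq_measure_of_null_sdiff (subset_univ (Function.support σ))]
  · simpa using hst
  · rw [← compl_eq_univ_sdiff]
    exact ae_iff.1 h

section Primitive

variable {σ : ℝ → ℝ≥0∞}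

theorem prim_ne_top (hfin : ∀ x ∈ Ioi (0 : ℝ), prim σ x < ∞) (x : ℝ) : prim σ x ≠ ∞ := by
  rcases le_or_gt x 0 with h | h
  · simp [prim_of_nonpos σ h]
  · exact (hfin x h).ne

theorem prim_pos (hσ : Measurable σ) (hpos : ∀ᵐ x ∂mu0, 0 < σ x) {x : ℝ} (hx : 0 < x) :
    prim σ x ≠ 0 := (lintegral_Ioc_pos hσ hpos le_rfl hx).ne'

theorem prim_strictMonoOn (hσ : Measurable σ) (hpos : ∀ᵐ x ∂mu0, 0 < σ x)
    (hfin : ∀ x ∈ Ioi (0 : ℝ), prim σ x < ∞) :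
    StrictMonoOn (fun x => (prim σ x).toReal) (Ici 0) := by
  intro s hs t _ hst
  refine (ENNReal.toReal_lt_toReal (prim_ne_top hfin s) (prim_ne_top hfin t)).2 ?_
  rw [← prim_add σ hs hst.le]
  exact ENNReal.lt_add_right (prim_ne_top hfin s) (lintegral_Ioc_pos hσ hpos hs hst).ne'

theorem prim_continuousOn (hσ : Measurable σ)
    (hfin : ∀ x ∈ Ioi (0 : ℝ), prim σ x < ∞) (x : ℝ) :
    ContinuousOn (fun x => (prim σ x).toReal) (Icc 0 x) := by
  have hne : ∫⁻ t in Icc (0 : ℝ) x, σ t ≠ ∞ := by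
    rw [← setLIntegral_congr Ioc_ae_eq_Icc]
    exact prim_ne_top hfin x
  have hint : IntegrableOn (fun t => (σ t).toReal) (Icc 0 x) :=
    integrable_toReal_of_lintegral_ne_top hσ.aemeasurable hne
  refine (intervalIntegral.continuousOn_primitive hint).congr fun t ht => ?_
  refine (integral_toReal hσ.aemeasurable ?_).symm
  exact ae_lt_top hσ (prim_ne_top hfin t)

/-- The measure `σ dt` is carried by its distribution function to Lebesgue measure. -/
theorem map_prim (hσ : Measurable σ) (hpos : ∀ᵐ x ∂mu0, 0 < σ x)
    (hfin : ∀ x ∈ Ioi (0 : ℝ), prim σ x < ∞) {s x : ℝ} (hs : 0 ≤ s) (hsx : s ≤ x) :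
    ((volume.restrict (Ioc s x)).withDensity σ).map (fun t => (prim σ t).toReal) =
      volume.restrict (Ioc (prim σ s).toReal (prim σ x).toReal) := by
  have hmeas : Measurable fun t => (prim σ t).toReal := (measurable_prim σ).ennreal_toReal
  have hmono := prim_strictMonoOn hσ hpos hfin
  have hIoc : ∀ y, s ≤ y → ∫⁻ u in Ioc s y, σ u =
      ENNReal.ofReal ((prim σ y).toReal - (prim σ s).toReal) := fun y hy => by
    rw [ENNReal.ofReal_sub _ ENNReal.toReal_nonneg, ENNReal.ofReal_toReal (prim_ne_top hfin _),
      ENNReal.ofReal_toReal (prim_ne_top hfin _), ← prim_add σ hs hy,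
      ENNReal.add_sub_cancel_left (prim_ne_top hfin _)]
  have : IsFiniteMeasure ((volume.restrict (Ioc s x)).withDensity σ) := by
    refine isFiniteMeasure_withDensity ?_
    rw [hIoc x hsx]
    exact ENNReal.ofReal_ne_top
  refine Measure.ext_of_Iic _ _ fun u => ?_
  rw [Measure.map_apply hmeas measurableSet_Iic, withDensity_apply _ (hmeas measurableSet_Iic),
    Measure.restrict_apply measurableSet_Iic, Measure.restrict_restrict (hmeas measurableSet_Iic)]
  have key : ∀ y, s ≤ y → y ≤ x → (∀ t ∈ Ioc s x, (prim σ t).toReal ≤ u ↔ t ≤ y) →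
      Iic u ∩ Ioc (prim σ s).toReal (prim σ x).toReal =
        Ioc (prim σ s).toReal (prim σ y).toReal →
      ∫⁻ a in (fun t => (prim σ t).toReal) ⁻¹' Iic u ∩ Ioc s x, σ a =
        volume (Iic u ∩ Ioc (prim σ s).toReal (prim σ x).toReal) := by
    intro y hsy hyx hy hI
    have : (fun t => (prim σ t).toReal) ⁻¹' Iic u ∩ Ioc s x = Ioc s y := by
      ext t
      constructor
      · rintro ⟨h1, h2⟩
        exact ⟨h2.1, (hy t h2).1 h1⟩
      · rintro ⟨h1, h2⟩
        exact ⟨(hy t ⟨h1, h2.trans hyx⟩).2 h2, h1, h2.trans hyx⟩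
    rw [this, hIoc y hsy, hI, Real.volume_Ioc]
  rcases lt_or_ge u (prim σ s).toReal with hu | hu
  · refine key s le_rfl hsx (fun t ht => ?_) ?_
    · have := hmono hs (hs.trans ht.1.le) ht.1
      simp only at this
      constructor
      · intro h; linarith
      · intro h; linarith [ht.1]
    · ext t
      simp only [mem_inter_iff, mem_Iic, mem_Ioc]
      constructor
      · rintro ⟨h1, h2, h3⟩; linarith
      · rintro ⟨h1, h2⟩; linarith
  rcases lt_or_ge (prim σ x).toReal u with hu' | hu'
  · refine key x hsx le_rfl (fun t ht => ?_) ?_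
    · refine ⟨fun _ => ht.2, fun h => le_trans ?_ hu'.le⟩
      exact hmono.monotoneOn (hs.trans ht.1.le) (hs.trans hsx) h
    · refine inter_eq_right.2 fun t ht => ?_
      exact ht.2.trans hu'.le
  obtain ⟨y, hy, rfl⟩ := intermediate_value_Icc hsx
    ((prim_continuousOn hσ hfin x).mono (Icc_subset_Icc_left hs)) ⟨hu, hu'⟩
  refine key y hy.1 hy.2 (fun t ht => ?_) ?_
  · exact hmono.le_iff_le (hs.trans ht.1.le) (hs.trans hy.1)
  · ext t
    simp only [mem_inter_iff, mem_Iic, mem_Ioc] at hu' ⊢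
    constructor
    · rintro ⟨h1, h2, h3⟩; exact ⟨h2, h1⟩
    · rintro ⟨h1, h2⟩; exact ⟨h2, h1, h2.trans hu'⟩

theorem lintegral_mul_prim_rpow (hσ : Measurable σ) (hpos : ∀ᵐ x ∂mu0, 0 < σ x)
    (hfin : ∀ x ∈ Ioi (0 : ℝ), prim σ x < ∞) {s x r : ℝ} (hs : 0 ≤ s) (hsx : s ≤ x)
    (hr : r ≠ 0) (hsr : 0 < r ∨ 0 < s) :
    ∫⁻ t in Ioc s x, σ t * prim σ t ^ (r - 1) =
      ENNReal.ofReal (((prim σ x).toReal ^ r - (prim σ s).toReal ^ r) / r) := by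
  have hmeas : Measurable fun t => (prim σ t).toReal := (measurable_prim σ).ennreal_toReal
  have hle : (prim σ s).toReal ≤ (prim σ x).toReal :=
    (prim_strictMonoOn hσ hpos hfin).monotoneOn hs (hs.trans hsx) hsx
  have h1 : ∫⁻ t in Ioc s x, σ t * prim σ t ^ (r - 1) =
      ∫⁻ u in Ioc (prim σ s).toReal (prim σ x).toReal, ENNReal.ofReal (u ^ (r - 1)) := by
    rw [← map_prim hσ hpos hfin hs hsx, lintegral_map (by fun_prop) hmeas,
      lintegral_withDensity_eq_lintegral_mul _ hσ (by fun_prop)]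
    refine setLIntegral_congr_fun measurableSet_Ioc fun t ht => ?_
    have ht0 : 0 < t := hs.trans_lt ht.1
    have : 0 < (prim σ t).toReal :=
      ENNReal.toReal_pos (prim_pos hσ hpos ht0) (prim_ne_top hfin t)
    simp only [Pi.mul_apply]
    rw [← ENNReal.ofReal_rpow_of_pos this, ENNReal.ofReal_toReal (prim_ne_top hfin t)]
  have h0 : 0 < r ∨ (0 : ℝ) ∉ uIcc (prim σ s).toReal (prim σ x).toReal := by
    refine hsr.imp id fun h => ?_
    rw [uIcc_of_le hle]
    exact fun h' => absurd h'.1 (not_le.2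
      (ENNReal.toReal_pos (prim_pos hσ hpos h) (prim_ne_top hfin s)))
  have hint : IntervalIntegrable (fun u : ℝ => u ^ (r - 1)) volume
      (prim σ s).toReal (prim σ x).toReal := by
    rcases h0 with h | h
    · exact intervalIntegral.intervalIntegrable_rpow' (by linarith)
    · exact intervalIntegral.intervalIntegrable_rpow (Or.inr h)
  rw [h1, ← ofReal_integral_eq_lintegral_ofReal
      ((intervalIntegrable_iff_integrableOn_Ioc_of_le hle).1 hint),
    ← intervalIntegral.integral_of_le hle, integral_rpow]
  · simp
  · refine h0.imp (fun h => by linarith) fun h => ⟨fun h' => hr (by linarith), h⟩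
  · filter_upwards [ae_restrict_mem measurableSet_Ioc] with u hu
    exact Real.rpow_nonneg (ENNReal.toReal_nonneg.trans hu.1.le) _

theorem lintegral_mul_prim_rpow_add (hσ : Measurable σ) (hpos : ∀ᵐ x ∂mu0, 0 < σ x)
    (hfin : ∀ x ∈ Ioi (0 : ℝ), prim σ x < ∞) {s x r : ℝ} (hs : 0 ≤ s) (hsx : s ≤ x)
    (hr : 0 < r) :
    ENNReal.ofReal r * (∫⁻ t in Ioc s x, σ t * prim σ t ^ (r - 1)) + prim σ s ^ r =
      prim σ x ^ r := by
  have hle : (prim σ s).toReal ≤ (prim σ x).toReal :=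
    (prim_strictMonoOn hσ hpos hfin).monotoneOn hs (hs.trans hsx) hsx
  have hle' := Real.rpow_le_rpow ENNReal.toReal_nonneg hle hr.le
  have key : ∀ y, prim σ y ^ r = ENNReal.ofReal ((prim σ y).toReal ^ r) := fun y => by
    rw [← ENNReal.ofReal_rpow_of_nonneg ENNReal.toReal_nonneg hr.le,
      ENNReal.ofReal_toReal (prim_ne_top hfin y)]
  rw [lintegral_mul_prim_rpow hσ hpos hfin hs hsx hr.ne' (Or.inl hr), ← ENNReal.ofReal_mul hr.le,
    mul_div_cancel₀ _ hr.ne', key s, key x, ← ENNReal.ofReal_add (by linarith) (by positivity)]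
  simp

theorem lintegral_Ioi_mul_prim_rpow_le (hσ : Measurable σ) (hpos : ∀ᵐ x ∂mu0, 0 < σ x)
    (hfin : ∀ x ∈ Ioi (0 : ℝ), prim σ x < ∞) {s c : ℝ} (hs : 0 < s) (hc : 0 < c) :
    ∫⁻ t in Ioi s, σ t * prim σ t ^ (-c - 1) ≤ ENNReal.ofReal (1 / c) * prim σ s ^ (-c) := by
  have hU : Ioi s = ⋃ n : ℕ, Ioc s (s + n) := by
    ext t
    simp only [mem_Ioi, mem_iUnion, mem_Ioc]
    refine ⟨fun h => ?_, fun ⟨n, h⟩ => h.1⟩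
    obtain ⟨n, hn⟩ := exists_nat_ge (t - s)
    exact ⟨n, h, by linarith⟩
  have hdir : Directed (· ⊆ ·) fun n : ℕ => Ioc s (s + n) :=
    Monotone.directed_le fun m n h => Ioc_subset_Ioc_right (by gcongr)
  rw [hU, setLIntegral_iUnion_of_directed _ hdir]
  refine iSup_le fun n => ?_
  have hsn : s ≤ s + n := by simp
  have hs0 : 0 < (prim σ s).toReal :=
    ENNReal.toReal_pos (prim_pos hσ hpos hs) (prim_ne_top hfin s)
  rw [lintegral_mul_prim_rpow hσ hpos hfin hs.le hsn (neg_ne_zero.2 hc.ne') (Or.inr hs),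
    ← ENNReal.ofReal_toReal (prim_ne_top hfin s), ENNReal.ofReal_rpow_of_pos hs0,
    ← ENNReal.ofReal_mul (by positivity), ENNReal.toReal_ofReal hs0.le]
  refine ENNReal.ofReal_le_ofReal ?_
  have : 0 ≤ (prim σ (s + n)).toReal ^ (-c) := Real.rpow_nonneg ENNReal.toReal_nonneg _
  rw [div_neg, ← neg_div, neg_sub, one_div, inv_mul_eq_div]
  gcongr
  linarith

theorem lintegral_Ioi_mul_lintegral_Ioi {a k : ℝ → ℝ≥0∞} (ha : Measurable a)
    (hk : Measurable k) :
    ∫⁻ s in Ioi (0 : ℝ), a s * ∫⁻ t in Ioi s, k t = ∫⁻ t in Ioi (0 : ℝ), k t * prim a t := by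
  let F : ℝ → ℝ → ℝ≥0∞ := fun s t => {z : ℝ × ℝ | z.1 < z.2}.indicator
    (fun z => a z.1 * k z.2) (s, t)
  have hF : Measurable (Function.uncurry F) :=
    Measurable.indicator (by fun_prop) (measurableSet_lt measurable_fst measurable_snd)
  have h1 : ∀ s ∈ Ioi (0 : ℝ), a s * ∫⁻ t in Ioi s, k t = ∫⁻ t in Ioi (0 : ℝ), F s t := by
    intro s hs
    have : ∀ t, F s t = (Ioi s).indicator (fun t => a s * k t) t := fun t => by
      simp [F, indicator]
    simp_rw [this]
    rw [setLIntegral_indicator measurableSet_Ioi, inter_eq_left.2 (Ioi_subset_Ioi (le_of_lt hs)),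
      lintegral_const_mul _ hk]
  have h2 : ∀ t, k t * prim a t = ∫⁻ s in Ioi (0 : ℝ), F s t := by
    intro t
    have : ∀ s, F s t = (Iio t).indicator (fun s => k t * a s) s := fun s => by
      simp [F, indicator, mul_comm]
    simp_rw [this]
    rw [setLIntegral_indicator measurableSet_Iio, Iio_inter_Ioi,
      lintegral_const_mul _ ha, prim, setLIntegral_congr Ioo_ae_eq_Ioc]
  rw [setLIntegral_congr_fun measurableSet_Ioi h1, lintegral_congr h2,
    lintegral_lintegral_swap hF.aemeasurable]

theorem lintegral_Ioc_mul_lintegral_Ioc {a k : ℝ → ℝ≥0∞} (ha : Measurable a)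
    (hk : Measurable k) (x : ℝ) :
    ∫⁻ s in Ioc (0 : ℝ) x, a s * ∫⁻ t in Ioc s x, k t =
      ∫⁻ t in Ioc (0 : ℝ) x, k t * prim a t := by
  have h := lintegral_Ioi_mul_lintegral_Ioi ha (hk.indicator (measurableSet_Iic (a := x)))
  have h1 : ∀ s, ∫⁻ t in Ioi s, (Iic x).indicator k t = ∫⁻ t in Ioc s x, k t := fun s => by
    rw [setLIntegral_indicator measurableSet_Iic, inter_comm, Ioi_inter_Iic]
  have h2 : ∀ t, (Iic x).indicator k t * prim a t =
      (Iic x).indicator (fun t => k t * prim a t) t := fun t => by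
    by_cases ht : t ∈ Iic x <;> simp [ht]
  have h3 : ∀ s, a s * ∫⁻ t in Ioc s x, k t =
      (Iic x).indicator (fun s => a s * ∫⁻ t in Ioc s x, k t) s := fun s => by
    by_cases hs : s ∈ Iic x
    · simp [hs]
    · have : Ioc s x = ∅ := Ioc_eq_empty_of_le (not_le.1 hs).le
      rw [indicator_of_notMem hs, this]
      simp
  simp_rw [h1, h2] at h
  rw [lintegral_congr h3, setLIntegral_indicator measurableSet_Iic,
    setLIntegral_indicator measurableSet_Iic, inter_comm, Ioi_inter_Iic] at h
  exact h

theorem prim_rpow_mul_rpow (hσ : Measurable σ) (hpos : ∀ᵐ x ∂mu0, 0 < σ x)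
    (hfin : ∀ x ∈ Ioi (0 : ℝ), prim σ x < ∞) {x : ℝ} (hx : 0 < x) {a b c : ℝ}
    (h : a + b = c) : prim σ x ^ a * prim σ x ^ b = prim σ x ^ c := by
  rw [← h, ENNReal.rpow_add _ _ (prim_pos hσ hpos hx) (prim_ne_top hfin x)]

/-- An averaging of `h` whose primitive dominates `(∫₀^x h)^(1/p)`. -/
def avg (p : ℝ) (σ h : ℝ → ℝ≥0∞) (s : ℝ) : ℝ≥0∞ :=
  σ s * (∫⁻ t in Ioi s, h t * prim σ t ^ (-p)) ^ (1 / p)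

theorem measurable_tail (k : ℝ → ℝ≥0∞) : Measurable fun s => ∫⁻ t in Ioi s, k t :=
  Antitone.measurable fun _ _ h => lintegral_mono_set (Ioi_subset_Ioi h)

theorem measurable_avg (p : ℝ) (hσ : Measurable σ) (h : ℝ → ℝ≥0∞) : Measurable (avg p σ h) :=
  hσ.mul ((measurable_tail _).pow_const _)

theorem lintegral_avg_rpow_mul {p : ℝ} (hp : 1 < p) {v : ℝ → ℝ≥0∞} (hσ : Measurable σ)
    (hpos : ∀ᵐ x ∂mu0, 0 < σ x) (hfin : ∀ x ∈ Ioi (0 : ℝ), prim σ x < ∞)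
    (hσv : ∀ᵐ x ∂mu0, σ x ^ p * v x = σ x) {h : ℝ → ℝ≥0∞} (hh : Measurable h) :
    ∫⁻ s in Ioi (0 : ℝ), avg p σ h s ^ p * v s =
      ∫⁻ t in Ioi (0 : ℝ), h t * prim σ t ^ (1 - p) := by
  have hp0 : 0 < p := by linarith
  have hU := measurable_prim σ
  calc ∫⁻ s in Ioi (0 : ℝ), avg p σ h s ^ p * v s
      = ∫⁻ s in Ioi (0 : ℝ), σ s * ∫⁻ t in Ioi s, h t * prim σ t ^ (-p) := by
        refine lintegral_congr_ae ?_
        filter_upwards [hσv] with s hs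
        rw [avg, ENNReal.mul_rpow_of_nonneg _ _ hp0.le, ← ENNReal.rpow_mul,
          one_div_mul_cancel hp0.ne', ENNReal.rpow_one, mul_right_comm, hs]
    _ = ∫⁻ t in Ioi (0 : ℝ), h t * prim σ t ^ (-p) * prim σ t :=
        lintegral_Ioi_mul_lintegral_Ioi hσ (by fun_prop)
    _ = ∫⁻ t in Ioi (0 : ℝ), h t * prim σ t ^ (1 - p) := by
        refine setLIntegral_congr_fun measurableSet_Ioi fun t ht => ?_
        rw [mul_assoc, ← prim_rpow_mul_rpow hσ hpos hfin ht (show -p + 1 = 1 - p by ring),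
          ENNReal.rpow_one]

theorem rpow_prim_le_prim_avg {p p' : ℝ} (hpp : p.HolderConjugate p') (hσ : Measurable σ)
    (hpos : ∀ᵐ x ∂mu0, 0 < σ x) (hfin : ∀ x ∈ Ioi (0 : ℝ), prim σ x < ∞)
    {h : ℝ → ℝ≥0∞} (hh : Measurable h) (x : ℝ) (hx : prim h x ≠ ∞) :
    prim h x ^ (1 / p) ≤ prim (avg p σ h) x := by
  have hp0 : 0 < p := hpp.pos
  have hp'0 : 0 < p' := hpp.symm.pos
  have hsum : 1 / p + 1 / p' = 1 := by
    simpa using hpp.inv_add_inv_eq_one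
  have hU := measurable_prim σ
  rcases eq_or_ne (prim h x) 0 with h0 | h0
  · simp [h0, hp0]
  have hole : ∀ s ∈ Ioc 0 x, ∫⁻ t in Ioc s x, h t * prim σ t ^ (-1 : ℝ) ≤
      (∫⁻ t in Ioi s, h t * prim σ t ^ (-p)) ^ (1 / p) * prim h x ^ (1 / p') := by
    intro s hs
    have H := ENNReal.lintegral_mul_le_Lp_mul_Lq (volume.restrict (Ioc s x)) hpp
      (f := fun t => h t ^ (1 / p) * prim σ t ^ (-1 : ℝ)) (g := fun t => h t ^ (1 / p'))
      (by fun_prop) (by fun_prop)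
    calc ∫⁻ t in Ioc s x, h t * prim σ t ^ (-1 : ℝ)
        = ∫⁻ t in Ioc s x, ((fun t => h t ^ (1 / p) * prim σ t ^ (-1 : ℝ)) *
            (fun t => h t ^ (1 / p'))) t := by
          refine lintegral_congr fun t => ?_
          simp only [Pi.mul_apply]
          rw [mul_right_comm, ← ENNReal.rpow_add_of_nonneg _ _ (by positivity) (by positivity),
            hsum, ENNReal.rpow_one]
      _ ≤ _ := H
      _ ≤ _ := by
          gcongr ?_ ^ _ * ?_ ^ _
          · refine (lintegral_mono_set Ioc_subset_Ioi_self).trans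
              (lintegral_mono fun t => ?_)
            rw [ENNReal.mul_rpow_of_nonneg _ _ hp0.le, ← ENNReal.rpow_mul, ← ENNReal.rpow_mul,
              one_div_mul_cancel hp0.ne', ENNReal.rpow_one, neg_one_mul]
          · refine (lintegral_mono_set (Ioc_subset_Ioc_left hs.1.le)).trans
              (lintegral_mono fun t => ?_)
            rw [← ENNReal.rpow_mul, one_div_mul_cancel hp'0.ne', ENNReal.rpow_one]
  have key : prim h x ≤ prim (avg p σ h) x * prim h x ^ (1 / p') := by
    calc prim h x = ∫⁻ t in Ioc (0 : ℝ) x, h t * prim σ t ^ (-1 : ℝ) * prim σ t := by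
          refine setLIntegral_congr_fun measurableSet_Ioc fun t ht => ?_
          have := prim_rpow_mul_rpow hσ hpos hfin ht.1 (show (-1 : ℝ) + 1 = 0 by ring)
          rw [ENNReal.rpow_one, ENNReal.rpow_zero] at this
          rw [mul_assoc, this, mul_one]
      _ = ∫⁻ s in Ioc (0 : ℝ) x, σ s * ∫⁻ t in Ioc s x, h t * prim σ t ^ (-1 : ℝ) :=
          (lintegral_Ioc_mul_lintegral_Ioc hσ (by fun_prop) x).symm
      _ ≤ ∫⁻ s in Ioc (0 : ℝ) x, avg p σ h s * prim h x ^ (1 / p') := by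
          refine setLIntegral_mono ((measurable_avg p hσ h).mul_const _) fun s hs => ?_
          rw [avg, mul_assoc]
          gcongr
          exact hole s hs
      _ = _ := lintegral_mul_const _ (measurable_avg p hσ h)
  have hne : prim h x ^ (1 / p') ≠ 0 := by simp [h0, hx]
  have hnt : prim h x ^ (1 / p') ≠ ∞ := ENNReal.rpow_ne_top_of_nonneg (by positivity) hx
  refine (ENNReal.mul_le_mul_iff_left hne hnt).1 ?_
  rwa [← ENNReal.rpow_add _ _ h0 hx, hsum, ENNReal.rpow_one]

/-- A function whose primitive is `U^b ∫₀^x k`, where `U = ∫₀^x σ`. -/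
def primMulDeriv (b : ℝ) (σ k : ℝ → ℝ≥0∞) (t : ℝ) : ℝ≥0∞ :=
  prim σ t ^ b * k t + ENNReal.ofReal b * (σ t * prim σ t ^ (b - 1) * prim k t)

theorem measurable_primMulDeriv (b : ℝ) {k : ℝ → ℝ≥0∞} (hσ : Measurable σ) (hk : Measurable k) :
    Measurable (primMulDeriv b σ k) := by
  have hU := measurable_prim σ
  have hK := measurable_prim k
  unfold primMulDeriv
  fun_prop

theorem prim_primMulDeriv (hσ : Measurable σ) (hpos : ∀ᵐ x ∂mu0, 0 < σ x)
    (hfin : ∀ x ∈ Ioi (0 : ℝ), prim σ x < ∞) {b : ℝ} (hb : 0 < b) {k : ℝ → ℝ≥0∞}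
    (hk : Measurable k) (x : ℝ) :
    prim (primMulDeriv b σ k) x = prim σ x ^ b * prim k x := by
  have hU := measurable_prim σ
  have hK := measurable_prim k
  have hm : Measurable fun t => ∫⁻ s in Ioc t x, σ s * prim σ s ^ (b - 1) :=
    Antitone.measurable fun _ _ h => lintegral_mono_set (Ioc_subset_Ioc_left h)
  calc prim (primMulDeriv b σ k) x
      = (∫⁻ t in Ioc 0 x, prim σ t ^ b * k t) + ENNReal.ofReal b *
          ∫⁻ t in Ioc 0 x, σ t * prim σ t ^ (b - 1) * prim k t := by
        rw [← lintegral_const_mul _ (by fun_prop), ← lintegral_add_left (by fun_prop)]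
        rfl
    _ = (∫⁻ t in Ioc 0 x, prim σ t ^ b * k t) + ENNReal.ofReal b *
          ∫⁻ t in Ioc 0 x, k t * ∫⁻ s in Ioc t x, σ s * prim σ s ^ (b - 1) := by
        rw [lintegral_Ioc_mul_lintegral_Ioc hk (by fun_prop)]
    _ = ∫⁻ t in Ioc 0 x, (prim σ t ^ b * k t + ENNReal.ofReal b *
          (k t * ∫⁻ s in Ioc t x, σ s * prim σ s ^ (b - 1))) := by
        rw [← lintegral_const_mul _ (by fun_prop), ← lintegral_add_left (by fun_prop)]
    _ = ∫⁻ t in Ioc 0 x, prim σ x ^ b * k t := by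
        refine setLIntegral_congr_fun measurableSet_Ioc fun t ht => ?_
        simp only [← lintegral_mul_prim_rpow_add hσ hpos hfin ht.1.le ht.2 hb]
        ring
    _ = prim σ x ^ b * prim k x := lintegral_const_mul _ hk

theorem lintegral_primMulDeriv_le (hσ : Measurable σ) (hpos : ∀ᵐ x ∂mu0, 0 < σ x)
    (hfin : ∀ x ∈ Ioi (0 : ℝ), prim σ x < ∞) {b c d : ℝ} (hc : 0 < c) (hd : b + d = -c)
    {k : ℝ → ℝ≥0∞} (hk : Measurable k) :
    ∫⁻ t in Ioi (0 : ℝ), primMulDeriv b σ k t * prim σ t ^ d ≤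
      (1 + ENNReal.ofReal b * ENNReal.ofReal (1 / c)) *
        ∫⁻ t in Ioi (0 : ℝ), k t * prim σ t ^ (-c) := by
  have hU := measurable_prim σ
  have hK := measurable_prim k
  calc ∫⁻ t in Ioi (0 : ℝ), primMulDeriv b σ k t * prim σ t ^ d
      = ∫⁻ t in Ioi (0 : ℝ), (k t * prim σ t ^ (-c) +
          ENNReal.ofReal b * (σ t * prim σ t ^ (-c - 1) * prim k t)) := by
        refine setLIntegral_congr_fun measurableSet_Ioi fun t ht => ?_
        simp only [primMulDeriv]
        rw [← prim_rpow_mul_rpow hσ hpos hfin ht hd,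
          ← prim_rpow_mul_rpow hσ hpos hfin ht (show b - 1 + d = -c - 1 by linarith)]
        ring
    _ = (∫⁻ t in Ioi (0 : ℝ), k t * prim σ t ^ (-c)) + ENNReal.ofReal b *
          ∫⁻ t in Ioi (0 : ℝ), σ t * prim σ t ^ (-c - 1) * prim k t := by
        rw [lintegral_add_left (by fun_prop), lintegral_const_mul _ (by fun_prop)]
    _ = (∫⁻ t in Ioi (0 : ℝ), k t * prim σ t ^ (-c)) + ENNReal.ofReal b *
          ∫⁻ t in Ioi (0 : ℝ), k t * ∫⁻ s in Ioi t, σ s * prim σ s ^ (-c - 1) := by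
        rw [lintegral_Ioi_mul_lintegral_Ioi hk (by fun_prop)]
    _ ≤ (∫⁻ t in Ioi (0 : ℝ), k t * prim σ t ^ (-c)) + ENNReal.ofReal b *
          ∫⁻ t in Ioi (0 : ℝ), ENNReal.ofReal (1 / c) * (k t * prim σ t ^ (-c)) := by
        gcongr _ + _ * ?_
        refine setLIntegral_mono (by fun_prop) fun t ht => ?_
        rw [mul_left_comm]
        gcongr
        exact lintegral_Ioi_mul_prim_rpow_le hσ hpos hfin ht hc
    _ = _ := by
        rw [lintegral_const_mul _ (by fun_prop)]
        ring

/-- Weighted Hölder inequality with an auxiliary power of the primitive of `σ`. -/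
theorem prim_le_rpow {p p' : ℝ} (hpp : p.HolderConjugate p') (hσ : Measurable σ)
    (hpos : ∀ᵐ x ∂mu0, 0 < σ x) (hfin : ∀ x ∈ Ioi (0 : ℝ), prim σ x < ∞)
    {v : ℝ → ℝ≥0∞} (hv : Measurable v)
    (hσv : ∀ᵐ x ∂mu0, v x ^ (1 / p) * σ x ^ (1 / p') = 1) {g : ℝ → ℝ≥0∞} (hg : Measurable g)
    (x : ℝ) :
    prim g x ≤ (ENNReal.ofReal p' ^ (p - 1) * (prim σ x ^ ((p - 1) / p') *
      prim (fun t => g t ^ p * v t * prim σ t ^ (1 / p')) x)) ^ (1 / p) := by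
  have hp0 : 0 < p := hpp.pos
  have hp'0 : 0 < p' := hpp.symm.pos
  have hsum : 1 / p + 1 / p' = 1 := by simpa using hpp.inv_add_inv_eq_one
  have hU := measurable_prim σ
  rcases le_or_gt x 0 with hx | hx
  · simp [prim_of_nonpos g hx]
  have hσint : ∫⁻ t in Ioc 0 x, σ t * prim σ t ^ (-(1 / p)) =
      ENNReal.ofReal p' * prim σ x ^ (1 / p') := by
    have h := lintegral_mul_prim_rpow_add hσ hpos hfin le_rfl hx.le
      (r := 1 / p') (by positivity)
    rw [prim_of_nonpos σ le_rfl, ENNReal.zero_rpow_of_pos (by positivity), add_zero,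
      show 1 / p' - 1 = -(1 / p) by linarith] at h
    rw [← h, ← mul_assoc, ← ENNReal.ofReal_mul hp'0.le, mul_one_div_cancel hp'0.ne',
      ENNReal.ofReal_one, one_mul]
  have H := ENNReal.lintegral_mul_le_Lp_mul_Lq (volume.restrict (Ioc 0 x)) hpp
      (f := fun t => g t * v t ^ (1 / p) * prim σ t ^ (1 / p' * (1 / p)))
      (g := fun t => σ t ^ (1 / p') * prim σ t ^ (-(1 / p) * (1 / p')))
      (by fun_prop) (by fun_prop)
  have hσv' := ae_restrict_of_ae_restrict_of_subset
    (Ioc_subset_Ioi_self : Ioc 0 x ⊆ Ioi (0 : ℝ)) hσv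
  calc prim g x = ∫⁻ t in Ioc 0 x,
        ((fun t => g t * v t ^ (1 / p) * prim σ t ^ (1 / p' * (1 / p))) *
          (fun t => σ t ^ (1 / p') * prim σ t ^ (-(1 / p) * (1 / p')))) t := by
        refine lintegral_congr_ae ?_
        filter_upwards [hσv', ae_restrict_mem measurableSet_Ioc] with t ht ht'
        have hz := prim_rpow_mul_rpow hσ hpos hfin ht'.1
          (show 1 / p' * (1 / p) + -(1 / p) * (1 / p') = 0 by ring)
        rw [ENNReal.rpow_zero] at hz
        simp only [Pi.mul_apply]
        rw [mul_mul_mul_comm, hz, mul_one, mul_assoc, ht, mul_one]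
    _ ≤ _ := H
    _ = prim (fun t => g t ^ p * v t * prim σ t ^ (1 / p')) x ^ (1 / p) *
          (ENNReal.ofReal p' * prim σ x ^ (1 / p')) ^ (1 / p') := by
        rw [← hσint]
        congr 2
        · refine lintegral_congr fun t => ?_
          rw [ENNReal.mul_rpow_of_nonneg _ _ hp0.le, ENNReal.mul_rpow_of_nonneg _ _ hp0.le,
            ← ENNReal.rpow_mul, ← ENNReal.rpow_mul, mul_assoc (1 / p'),
            one_div_mul_cancel hp0.ne', mul_one, ENNReal.rpow_one]
        · refine lintegral_congr fun t => ?_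
          rw [ENNReal.mul_rpow_of_nonneg _ _ hp'0.le, ← ENNReal.rpow_mul, ← ENNReal.rpow_mul,
            mul_assoc (-(1 / p)), one_div_mul_cancel hp'0.ne', mul_one, ENNReal.rpow_one]
    _ = _ := by
        have e : (p - 1) * (1 / p) = 1 / p' := by
          rw [sub_mul, mul_one_div_cancel hp0.ne']
          linarith
        have e' : (p - 1) / p' * (1 / p) = 1 / p' * (1 / p') := by
          rw [← mul_one_div, mul_right_comm, e]
        rw [ENNReal.mul_rpow_of_nonneg _ _ (by positivity),
          ENNReal.mul_rpow_of_nonneg _ _ (by positivity),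
          ENNReal.mul_rpow_of_nonneg _ _ (by positivity), ← ENNReal.rpow_mul, ← ENNReal.rpow_mul,
          ← ENNReal.rpow_mul, e, e']
        ring

end Primitive

theorem wnorm_mono_const_mul {q : ℝ} (hq : 0 < q) {w f g : ℝ → ℝ≥0∞} {C : ℝ≥0}
    (h : ∀ᵐ x ∂mu0, f x ≤ C * g x) : wnorm q w f ≤ C * wnorm q w g := by
  have hC : (C : ℝ≥0∞) ^ q ≠ ∞ := ENNReal.rpow_ne_top_of_nonneg hq.le ENNReal.coe_ne_top
  calc wnorm q w f ≤ (∫⁻ x in Ioi (0 : ℝ), (C : ℝ≥0∞) ^ q * (g x ^ q * w x)) ^ (1 / q) := by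
        refine ENNReal.rpow_le_rpow (lintegral_mono_ae ?_) (by positivity)
        filter_upwards [h] with x hx
        rw [← mul_assoc, ← ENNReal.mul_rpow_of_nonneg _ _ hq.le]
        gcongr
    _ = C * wnorm q w g := by
        rw [lintegral_const_mul' _ _ hC, ENNReal.mul_rpow_of_nonneg _ _ (by positivity),
          ← ENNReal.rpow_mul, mul_one_div_cancel hq.ne', ENNReal.rpow_one, wnorm]

theorem wnorm_div_rpow {p q : ℝ} (hp : 0 < p) (w f : ℝ → ℝ≥0∞) :
    wnorm (q / p) w (fun x => f x ^ p) = wnorm q w f ^ p := by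
  simp only [wnorm, ← ENNReal.rpow_mul, mul_div_cancel₀ q hp.ne']
  congr 1
  rw [one_div_div, div_eq_mul_one_div, mul_comm]

theorem wnorm_one_Phi {p : ℝ} (hp : 1 < p) (v h : ℝ → ℝ≥0∞) :
    wnorm 1 (fun t => Phi p v t ^ (1 - 2 * p)) h =
      ∫⁻ t in Ioi (0 : ℝ), h t * prim (fun t => v t ^ (1 - p / (p - 1))) t ^ (1 - p) := by
  have hp1 : p - 1 ≠ 0 := by linarith
  have he : 1 / (p / (p - 1) + 1) * (1 - 2 * p) = 1 - p := by
    have : p + (p - 1) ≠ 0 := by linarith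
    field_simp
    ring
  simp only [wnorm, Phi, ENNReal.rpow_one, div_one, ← ENNReal.rpow_mul, he, prim]

theorem statement0 (p q : ℝ) (hq : 0 < q) (hp : 1 < p)
    (T : (ℝ → ℝ≥0∞) → ℝ → ℝ≥0∞) (hT : IsMQL T)
    (w v : ℝ → ℝ≥0∞) (hw : IsWeight w) (hv : IsWeight v)
    (hvfin : ∀ x ∈ Ioi (0 : ℝ), (∫⁻ t in Ioc (0 : ℝ) x, v t ^ (1 - p / (p - 1))) < ∞) :
    (∃ C : ℝ≥0, 0 < C ∧ ∀ h : ℝ → ℝ≥0∞, Measurable h →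
        wnorm q w (T fun x => ∫⁻ t in Ioc (0 : ℝ) x, h t) ≤ (C : ℝ≥0∞) * wnorm p v h) ↔
      (∃ C' : ℝ≥0, 0 < C' ∧ ∀ h : ℝ → ℝ≥0∞, Measurable h →
        wnorm (q / p) w
            (fun x => T (fun y => (∫⁻ t in Ioc (0 : ℝ) y, h t) ^ (1 / p)) x ^ p) ≤
          (C' : ℝ≥0∞) * wnorm 1 (fun t => Phi p v t ^ (1 - 2 * p)) h) := by
  have hp0 : 0 < p := by linarith
  have hpp : p.HolderConjugate (p / (p - 1)) := .conjExponent hp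
  have hp'0 := hpp.symm.pos
  have hsum : 1 / p + 1 / (p / (p - 1)) = 1 := by simpa using hpp.inv_add_inv_eq_one
  have hmul : (p / (p - 1) - 1) * (p - 1) = 1 := by
    have : p - 1 ≠ 0 := by linarith
    field_simp
    ring
  have hv0 := hv.1
  set σ : ℝ → ℝ≥0∞ := fun t => v t ^ (1 - p / (p - 1)) with hσdef
  have hσ : Measurable σ := by fun_prop
  have hpos : ∀ᵐ x ∂mu0, 0 < σ x := hv.2.mono fun x hx => ENNReal.rpow_pos hx.1 hx.2.ne
  have hσv : ∀ᵐ x ∂mu0, σ x ^ p * v x = σ x := hv.2.mono fun x hx => by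
    calc σ x ^ p * v x = v x ^ ((1 - p / (p - 1)) * p) * v x ^ (1 : ℝ) := by
          rw [ENNReal.rpow_one, ENNReal.rpow_mul]
      _ = σ x := by
          rw [← ENNReal.rpow_add _ _ hx.1.ne' hx.2.ne]
          congr 1
          linarith
  have hvσ : ∀ᵐ x ∂mu0, v x ^ (1 / p) * σ x ^ (1 / (p / (p - 1))) = 1 :=
    hv.2.mono fun x hx => by
      rw [← ENNReal.rpow_mul, ← ENNReal.rpow_add _ _ hx.1.ne' hx.2.ne, sub_mul,
        mul_one_div_cancel hp'0.ne', one_mul, ← add_sub_assoc, hsum, sub_self, ENNReal.rpow_zero]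
  obtain ⟨C₁, hC₁, hmono⟩ := hT.mono
  simp_rw [wnorm_div_rpow hp0, wnorm_one_Phi hp]
  constructor
  · rintro ⟨C, hC, H⟩
    refine ⟨(C₁ * C) ^ p, by positivity, fun h hh => ?_⟩
    rcases eq_or_ne (∫⁻ t in Ioi (0 : ℝ), h t * prim σ t ^ (1 - p)) ∞ with htop | htop
    · rw [htop, ENNReal.mul_top (ENNReal.coe_ne_zero.2 (by positivity))]
      exact le_top
    have hfinite : ∀ x ∈ Ioi (0 : ℝ), prim h x ≠ ∞ := by
      intro x hx
      have hc0 : prim σ x ^ (1 - p) ≠ 0 := by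
        simp only [ne_eq, ENNReal.rpow_eq_zero_iff, not_or, not_and]
        exact ⟨fun h => absurd h (prim_pos hσ hpos hx), fun h => absurd h (prim_ne_top hvfin x)⟩
      refine fun h' => htop (top_le_iff.1 ?_)
      calc ∞ = prim h x * prim σ x ^ (1 - p) := by rw [h', ENNReal.top_mul hc0]
        _ = ∫⁻ t in Ioc 0 x, h t * prim σ x ^ (1 - p) := (lintegral_mul_const _ hh).symm
        _ ≤ ∫⁻ t in Ioc 0 x, h t * prim σ t ^ (1 - p) := by
            have hU := measurable_prim σ
            refine setLIntegral_mono (by fun_prop) fun t ht => ?_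
            refine mul_le_mul_right ?_ _
            rw [← neg_sub p 1, ENNReal.rpow_neg, ENNReal.rpow_neg]
            gcongr
            exact prim_monotone σ ht.2
        _ ≤ _ := lintegral_mono_set Ioc_subset_Ioi_self
    have hle : wnorm q w (T fun y => prim h y ^ (1 / p)) ≤
        C₁ * wnorm q w (T (prim (avg p σ h))) := by
      refine wnorm_mono_const_mul hq (hmono _ _ ((measurable_prim h).pow_const _)
        (measurable_prim _) ?_)
      filter_upwards [ae_restrict_mem measurableSet_Ioi] with x hx
      exact rpow_prim_le_prim_avg hpp hσ hpos hvfin hh x (hfinite x hx)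
    have hfinal : wnorm q w (T fun y => prim h y ^ (1 / p)) ≤
        (C₁ * C : ℝ≥0) * (∫⁻ t in Ioi (0 : ℝ), h t * prim σ t ^ (1 - p)) ^ (1 / p) := by
      refine hle.trans ?_
      rw [← lintegral_avg_rpow_mul hp hσ hpos hvfin hσv hh, ENNReal.coe_mul, mul_assoc]
      gcongr
      exact H _ (measurable_avg p hσ h)
    calc _ ≤ ((C₁ * C : ℝ≥0) *
          (∫⁻ t in Ioi (0 : ℝ), h t * prim σ t ^ (1 - p)) ^ (1 / p)) ^ p :=
          ENNReal.rpow_le_rpow hfinal hp0.le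
      _ = _ := by
          rw [ENNReal.mul_rpow_of_nonneg _ _ hp0.le, ← ENNReal.rpow_mul,
            one_div_mul_cancel hp0.ne', ENNReal.rpow_one, ENNReal.coe_rpow_of_nonneg _ hp0.le]
  · rintro ⟨C', hC', H⟩
    set p' := p / (p - 1) with hp'
    have hb : 0 < (p - 1) / p' := div_pos (by linarith) hp'0
    set A : ℝ≥0∞ := ENNReal.ofReal p' ^ (p - 1) with hA
    have hAtop : A ≠ ∞ := ENNReal.rpow_ne_top_of_nonneg (by linarith) ENNReal.ofReal_ne_top
    have hA0 : A ≠ 0 := by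
      simp [hA, hp'0]
    set D : ℝ≥0∞ := A * (1 + ENNReal.ofReal ((p - 1) / p') * ENNReal.ofReal (1 / (1 / p')))
      with hD
    have hDtop : D ≠ ∞ := by finiteness
    have hD0 : D ≠ 0 := mul_ne_zero hA0 (by simp)
    have hDpos : 0 < D.toNNReal := ENNReal.toNNReal_pos hD0 hDtop
    refine ⟨C₁ * (C' * D.toNNReal) ^ (1 / p), by positivity, fun g hg => ?_⟩
    have hU := measurable_prim σ
    set k : ℝ → ℝ≥0∞ := fun t => g t ^ p * v t * prim σ t ^ (1 / p') with hk
    have hkm : Measurable k := by fun_prop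
    have hfm := measurable_primMulDeriv ((p - 1) / p') hσ hkm
    set h : ℝ → ℝ≥0∞ := fun t => A * primMulDeriv ((p - 1) / p') σ k t with hh
    have hhm : Measurable h := hfm.const_mul _
    have hle : wnorm q w (T (prim g)) ≤ C₁ * wnorm q w (T fun y => prim h y ^ (1 / p)) := by
      refine wnorm_mono_const_mul hq (hmono _ _ (measurable_prim g)
        ((measurable_prim h).pow_const _) (.of_forall fun x => ?_))
      have : prim h x = A * prim (primMulDeriv ((p - 1) / p') σ k) x :=
        lintegral_const_mul _ hfm
      rw [this, prim_primMulDeriv hσ hpos hvfin hb hkm]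
      exact prim_le_rpow hpp hσ hpos hvfin hv0 hvσ hg x
    have hint : ∫⁻ t in Ioi (0 : ℝ), h t * prim σ t ^ (1 - p) ≤
        D * ∫⁻ t in Ioi (0 : ℝ), g t ^ p * v t := by
      calc ∫⁻ t in Ioi (0 : ℝ), h t * prim σ t ^ (1 - p)
          = A * ∫⁻ t in Ioi (0 : ℝ),
              primMulDeriv ((p - 1) / p') σ k t * prim σ t ^ (1 - p) := by
            rw [← lintegral_const_mul _ (by fun_prop)]
            simp only [hh, mul_assoc]
        _ ≤ A * ((1 + ENNReal.ofReal ((p - 1) / p') * ENNReal.ofReal (1 / (1 / p'))) *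
              ∫⁻ t in Ioi (0 : ℝ), k t * prim σ t ^ (-(1 / p'))) := by
            gcongr
            refine lintegral_primMulDeriv_le hσ hpos hvfin (by positivity) ?_ hkm
            field_simp
            linarith
        _ = D * ∫⁻ t in Ioi (0 : ℝ), g t ^ p * v t := by
            rw [← mul_assoc, ← hD]
            congr 1
            refine setLIntegral_congr_fun measurableSet_Ioi fun t ht => ?_
            simp only [hk]
            rw [mul_assoc, prim_rpow_mul_rpow hσ hpos hvfin ht (add_neg_cancel _),
              ENNReal.rpow_zero, mul_one]
    refine hle.trans ?_
    rw [ENNReal.coe_mul, mul_assoc]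
    gcongr
    refine (ENNReal.rpow_le_rpow_iff hp0).1 ((H h hhm).trans ?_)
    rw [ENNReal.mul_rpow_of_nonneg _ _ hp0.le, wnorm, ← ENNReal.rpow_mul,
      ← ENNReal.coe_rpow_of_nonneg _ hp0.le, ← NNReal.rpow_mul,
      one_div_mul_cancel hp0.ne', ENNReal.rpow_one, NNReal.rpow_one, ENNReal.coe_mul,
      ENNReal.coe_toNNReal hDtop, mul_assoc]
    gcongr
end
end

section
/- Let 0 < q < ∞ and 1 < p < ∞, let T be a monotone quasilinear operator on M⁺(0,∞), let w be a weight on (0,∞), and let v be a weight on (0,∞) such that ∫_x^∞ v(t)^{1-p'} dt < ∞ for every x ∈ (0,∞). Then there exists a constant C > 0 such that ‖T(x ↦ ∫_x^∞ h(t) dt)‖_{q,w,(0,∞)} ≤ C ‖h‖_{p,v,(0,∞)} for all h ∈ M⁺(0,∞) if and only if there exists a constant C' > 0 such that ‖(T(x ↦ (∫_x^∞ h(t) dt)^{1/p}))^p‖_{q/p,w,(0,∞)} ≤ C' ‖h‖_{1,Ψ^{1-2p},(0,∞)} for all h ∈ M⁺(0,∞), where Ψ(x) := (∫_x^∞ v(t)^{1-p'}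 dt)^{1/(p'+1)}. -/
open MeasureTheory Set ENNReal NNReal

noncomputable section

/-- `Ψ(x) = (∫_x^∞ v(t)^(1-p') dt)^(1/(p'+1))`, where `p' = p/(p-1)`. -/
def Psi (p : ℝ) (v : ℝ → ℝ≥0∞) (x : ℝ) : ℝ≥0∞ :=
  (∫⁻ t in Ioi x, v t ^ (1 - p / (p - 1))) ^ (1 / (p / (p - 1) + 1))

/-- The tail function `x ↦ ν (x, ∞)` of a measure on `ℝ`. -/
def tail (ν : Measure ℝ) (x : ℝ) : ℝ≥0∞ := ν (Ioi x)

theorem tail_anti (ν : Measure ℝ) : Antitone (tail ν) := fun _ _ hxy =>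
  measure_mono (Ioi_subset_Ioi hxy)

@[fun_prop]
theorem measurable_tail_s1 (ν : Measure ℝ) : Measurable (tail ν) := (tail_anti ν).measurable

theorem continuousOn_toReal_tail {ν : Measure ℝ} [NullSingletonClass ν] {a : ℝ}
    (hfin : tail ν a < ∞) : ContinuousOn (fun x => (tail ν x).toReal) (Ici a) := by
  have hIci : IntegrableOn (fun _ => (1 : ℝ)) (Ici a) ν := by
    rw [integrableOn_const_iff (by simp)]
    right
    rwa [← measure_congr Ioi_ae_eq_Ici]
  have key : ∀ x ∈ Ici a,
      (tail ν x).toReal = (tail ν a).toReal - ∫ _ in Ioc a x, (1 : ℝ) ∂ν := by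
    intro x hx
    have hdisj : tail ν a = ν (Ioc a x) + tail ν x := by
      rw [tail, tail, ← measure_union (by
        rw [Set.disjoint_left]
        intro y hy hy'
        exact absurd hy.2 (not_le.2 hy')) measurableSet_Ioi, Ioc_union_Ioi_eq_Ioi hx]
    have h1 : ν (Ioc a x) ≠ ∞ := ((measure_mono Ioc_subset_Ioi_self).trans_lt hfin).ne
    have h2 : tail ν x ≠ ∞ := ((tail_anti ν hx).trans_lt hfin).ne
    rw [hdisj, ENNReal.toReal_add h1 h2]
    simp [Measure.real]
  refine ContinuousOn.congr ?_ key
  intro x hx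
  have hc := intervalIntegral.continuousOn_primitive (μ := ν) (f := fun _ => (1 : ℝ)) (a := a)
    (b := x + 1) (hIci.mono_set Icc_subset_Ici_self)
  have hcx := (hc x ⟨hx, by linarith⟩)
  refine ContinuousWithinAt.sub continuousWithinAt_const ?_
  refine hcx.mono_of_mem_nhdsWithin ?_
  have : Iio (x + 1) ∈ nhds x := Iio_mem_nhds (by linarith)
  filter_upwards [self_mem_nhdsWithin, mem_nhdsWithin_of_mem_nhds this] with y hy hy'
  exact ⟨hy, le_of_lt hy'⟩

theorem exists_tail_lt {ν : Measure ℝ} {a : ℝ} (hfin : tail ν a < ∞) {c : ℝ≥0∞}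
    (hc : 0 < c) : ∃ b, a ≤ b ∧ tail ν b < c := by
  have hanti : Antitone fun n : ℕ => Ioi (a + n) := fun m n hmn =>
    Ioi_subset_Ioi (by gcongr)
  have h := tendsto_measure_iInter_atTop (μ := ν) (s := fun n : ℕ => Ioi (a + n))
    (fun n => measurableSet_Ioi.nullMeasurableSet) hanti ⟨0, by simpa [tail] using hfin.ne⟩
  have hempty : (⋂ n : ℕ, Ioi (a + n)) = ∅ := by
    ext y
    simp only [mem_iInter, mem_Ioi, mem_empty_iff_false, iff_false, not_forall, not_lt]
    obtain ⟨n, hn⟩ := exists_nat_ge (y - a)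
    exact ⟨n, by linarith⟩
  rw [hempty, measure_empty] at h
  obtain ⟨n, hn⟩ := (h.eventually_lt_const hc).exists
  exact ⟨a + n, by simp, hn⟩

/-- The tail function of an atomless measure pushes the measure forward to Lebesgue measure. -/
theorem map_toReal_tail {ν : Measure ℝ} [NullSingletonClass ν] {a : ℝ}
    (hfin : tail ν a < ∞) (hpos : ∀ x, a < x → 0 < tail ν x) :
    (ν.restrict (Ioi a)).map (fun x => (tail ν x).toReal) =
      volume.restrict (Ioc 0 (tail ν a).toReal) := by
  have hmeas : Measurable fun x => (tail ν x).toReal := (measurable_tail_s1 ν).ennreal_toReal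
  have hle : ∀ x, a ≤ x → tail ν x ≤ tail ν a := fun x hx => tail_anti ν hx
  have hne : ∀ x, a ≤ x → tail ν x ≠ ∞ := fun x hx => ((hle x hx).trans_lt hfin).ne
  have : IsFiniteMeasure (ν.restrict (Ioi a)) := ⟨by simpa [tail] using hfin⟩
  have : IsFiniteMeasure ((ν.restrict (Ioi a)).map fun x => (tail ν x).toReal) :=
    Measure.isFiniteMeasure_map _ _
  refine Measure.ext_of_Iic _ _ fun c => ?_
  rw [Measure.map_apply hmeas measurableSet_Iic,
    Measure.restrict_apply (hmeas measurableSet_Iic), Measure.restrict_apply measurableSet_Iic]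
  rcases le_or_gt c 0 with hc | hc
  · have h1 : (fun x => (tail ν x).toReal) ⁻¹' Iic c ∩ Ioi a = ∅ := by
      ext x
      simp only [mem_inter_iff, mem_preimage, mem_Iic, mem_Ioi, mem_empty_iff_false, iff_false,
        not_and, not_lt]
      intro hx
      by_contra! hax
      exact absurd (ENNReal.toReal_pos (hpos x hax).ne' (hne x hax.le)) (not_lt.2 (hx.trans hc))
    have h2 : Iic c ∩ Ioc 0 (tail ν a).toReal = ∅ := by
      ext x
      simp only [mem_inter_iff, mem_Iic, mem_Ioc, mem_empty_iff_false, iff_false]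
      rintro ⟨h, h', -⟩
      linarith
    rw [h1, h2]
    simp
  rcases le_or_gt (tail ν a).toReal c with hca | hca
  · have h1 : (fun x => (tail ν x).toReal) ⁻¹' Iic c ∩ Ioi a = Ioi a := by
      refine inter_eq_right.2 fun x hx => ?_
      exact (ENNReal.toReal_mono hfin.ne (hle x (le_of_lt hx))).trans hca
    have h2 : Iic c ∩ Ioc 0 (tail ν a).toReal = Ioc 0 (tail ν a).toReal :=
      inter_eq_right.2 fun x hx => hx.2.trans hca
    rw [h1, h2, Real.volume_Ioc, sub_zero, ENNReal.ofReal_toReal hfin.ne, tail]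
  have h2 : Iic c ∩ Ioc 0 (tail ν a).toReal = Ioc 0 c := by
    ext x
    simp only [mem_inter_iff, mem_Iic, mem_Ioc]
    exact ⟨fun h => ⟨h.2.1, h.1⟩, fun h => ⟨h.2, h.1, h.2.trans hca.le⟩⟩
  rw [h2, Real.volume_Ioc, sub_zero]
  have hcont := continuousOn_toReal_tail hfin
  obtain ⟨b, hab, hb⟩ := exists_tail_lt hfin (ENNReal.ofReal_pos.2 hc)
  have hbc : (tail ν b).toReal ≤ c := ENNReal.toReal_le_of_le_ofReal hc.le hb.le
  apply le_antisymm
  · set S := Ici a ∩ (fun x => (tail ν x).toReal) ⁻¹' Iic c with hS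
    have hclosed : IsClosed S := hcont.preimage_isClosed_of_isClosed isClosed_Ici isClosed_Iic
    have hbdd : BddBelow S := ⟨a, fun x hx => hx.1⟩
    have hmem : sInf S ∈ S := hclosed.csInf_mem ⟨b, hab, hbc⟩ hbdd
    calc _ ≤ ν (Ici (sInf S)) :=
          measure_mono fun x hx => csInf_le hbdd ⟨(mem_Ioi.1 hx.2).le, hx.1⟩
      _ = tail ν (sInf S) := (measure_congr Ioi_ae_eq_Ici).symm
      _ ≤ ENNReal.ofReal c :=
          (ENNReal.le_ofReal_iff_toReal_le (hne _ hmem.1) hc.le).2 hmem.2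
  · obtain ⟨y, hy, hyc⟩ := intermediate_value_Icc' hab (hcont.mono Icc_subset_Ici_self)
      ⟨hbc, hca.le⟩
    simp only at hyc
    calc ENNReal.ofReal c = tail ν y := by rw [← hyc, ENNReal.ofReal_toReal (hne y hy.1)]
      _ ≤ ν ((fun x => (tail ν x).toReal) ⁻¹' Iic c ∩ Ioi a) := by
          refine measure_mono fun x hx => ⟨?_, lt_of_le_of_lt hy.1 hx⟩
          rw [mem_preimage, mem_Iic, ← hyc]
          exact ENNReal.toReal_mono (hne y hy.1) (tail_anti ν (le_of_lt hx))

theorem lintegral_Ioc_ofReal_rpow {r c : ℝ} (hr : -1 < r) (hc : 0 < c) :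
    ∫⁻ u in Ioc 0 c, ENNReal.ofReal u ^ r =
      ENNReal.ofReal (1 / (r + 1)) * ENNReal.ofReal c ^ (r + 1) := by
  have hint : IntegrableOn (fun u : ℝ => u ^ r) (Ioc 0 c) :=
    (intervalIntegrable_iff_integrableOn_Ioc_of_le hc.le).1
      (intervalIntegral.intervalIntegrable_rpow' hr)
  have h := ofReal_integral_eq_lintegral_ofReal hint
    ((ae_restrict_iff' measurableSet_Ioc).2 (ae_of_all _ fun u hu => Real.rpow_nonneg hu.1.le r))
  rw [← intervalIntegral.integral_of_le hc.le, integral_rpow (Or.inl hr),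
    Real.zero_rpow (by linarith)] at h
  rw [ENNReal.ofReal_rpow_of_pos hc, ← ENNReal.ofReal_mul (by
    have : 0 < r + 1 := by linarith
    positivity)]
  convert h.symm using 1
  · exact setLIntegral_congr_fun measurableSet_Ioc fun u hu => ENNReal.ofReal_rpow_of_pos hu.1
  · congr 1; ring

theorem lintegral_Ioi_ofReal_rpow {r c : ℝ} (hr : r < -1) (hc : 0 < c) :
    ∫⁻ u in Ioi c, ENNReal.ofReal u ^ r =
      ENNReal.ofReal (1 / (-r - 1)) * ENNReal.ofReal c ^ (r + 1) := by
  have h := ofReal_integral_eq_lintegral_ofReal (integrableOn_Ioi_rpow_of_lt hr hc)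
    ((ae_restrict_iff' measurableSet_Ioi).2
      (ae_of_all _ fun u hu => Real.rpow_nonneg (hc.trans hu).le r))
  rw [integral_Ioi_rpow_of_lt hr hc] at h
  rw [ENNReal.ofReal_rpow_of_pos hc, ← ENNReal.ofReal_mul (by
    have : 0 < -r - 1 := by linarith
    positivity)]
  convert h.symm using 1
  · exact setLIntegral_congr_fun measurableSet_Ioi fun u hu =>
      ENNReal.ofReal_rpow_of_pos (hc.trans hu)
  · congr 1
    have : -r - 1 ≠ 0 := by linarith
    have : r + 1 ≠ 0 := by linarith
    field_simp
    ring

/-- `∫_a^∞ F^r dν = F(a)^(r+1) / (r+1)` for the tail function `F` of `ν` and `r > -1`. -/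
theorem lintegral_Ioi_tail_rpow {ν : Measure ℝ} [NullSingletonClass ν] {a r : ℝ}
    (hfin : tail ν a < ∞) (hpos : ∀ x, a ≤ x → 0 < tail ν x) (hr : -1 < r) :
    ∫⁻ x in Ioi a, tail ν x ^ r ∂ν = ENNReal.ofReal (1 / (r + 1)) * tail ν a ^ (r + 1) := by
  have hmeas : Measurable fun x => (tail ν x).toReal := (measurable_tail_s1 ν).ennreal_toReal
  have h := lintegral_map (μ := ν.restrict (Ioi a)) (f := fun u => ENNReal.ofReal u ^ r)
    (by fun_prop) hmeas
  rw [map_toReal_tail hfin fun x hx => hpos x hx.le,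
    lintegral_Ioc_ofReal_rpow hr (ENNReal.toReal_pos (hpos a le_rfl).ne' hfin.ne),
    ENNReal.ofReal_toReal hfin.ne] at h
  rw [h]
  refine setLIntegral_congr_fun measurableSet_Ioi fun x hx => ?_
  rw [ENNReal.ofReal_toReal ((tail_anti ν (le_of_lt hx)).trans_lt hfin).ne]

/-- `∫_0^t F^r dν ≤ F(t)^(r+1) / (-r-1)` for the tail function `F` of `ν` and `r < -1`. -/
theorem lintegral_Ioc_tail_rpow_le {ν : Measure ℝ} [NullSingletonClass ν] {t r : ℝ}
    (hfin : ∀ x, 0 < x → tail ν x < ∞) (hpos : ∀ x, 0 < x → 0 < tail ν x) (hr : r < -1)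
    (ht : 0 < t) :
    ∫⁻ x in Ioc 0 t, tail ν x ^ r ∂ν ≤ ENNReal.ofReal (1 / (-r - 1)) * tail ν t ^ (r + 1) := by
  have hmeas : Measurable fun x => (tail ν x).toReal := (measurable_tail_s1 ν).ennreal_toReal
  have hFt : 0 < (tail ν t).toReal := ENNReal.toReal_pos (hpos t ht).ne' (hfin t ht).ne
  have hunion : Ioc 0 t = ⋃ n : ℕ, Ioc (1 / ((n : ℝ) + 1)) t := by
    ext x
    simp only [mem_Ioc, mem_iUnion]
    constructor
    · rintro ⟨h0, h1⟩
      obtain ⟨n, hn⟩ := exists_nat_one_div_lt h0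
      exact ⟨n, hn, h1⟩
    · rintro ⟨n, h0, h1⟩
      exact ⟨lt_trans (by positivity) h0, h1⟩
  have hdir : Directed (· ⊆ ·) fun n : ℕ => Ioc (1 / ((n : ℝ) + 1)) t :=
    Monotone.directed_le fun m n hmn => Ioc_subset_Ioc_left (by gcongr)
  rw [hunion, setLIntegral_iUnion_of_directed _ hdir]
  refine iSup_le fun n => ?_
  set a : ℝ := 1 / ((n : ℝ) + 1)
  have ha : 0 < a := by positivity
  set f : ℝ → ℝ≥0∞ := (Ici (tail ν t).toReal).indicator fun u => ENNReal.ofReal u ^ r with hf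
  have hfm : Measurable f := Measurable.indicator (by fun_prop) measurableSet_Ici
  calc ∫⁻ x in Ioc a t, tail ν x ^ r ∂ν
      = ∫⁻ x in Ioc a t, f (tail ν x).toReal ∂ν := by
        refine setLIntegral_congr_fun measurableSet_Ioc fun x hx => ?_
        have hx0 := ha.trans hx.1
        have : (tail ν x).toReal ∈ Ici (tail ν t).toReal :=
          ENNReal.toReal_mono (hfin x hx0).ne (tail_anti ν hx.2)
        simp only [hf]
        rw [indicator_of_mem this, ENNReal.ofReal_toReal (hfin x hx0).ne]
    _ ≤ ∫⁻ x in Ioi a, f (tail ν x).toReal ∂ν := lintegral_mono_set Ioc_subset_Ioi_self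
    _ = ∫⁻ u in Ioc 0 (tail ν a).toReal, f u := by
        rw [← map_toReal_tail (hfin a ha) fun x hx => hpos x (ha.trans hx),
          lintegral_map hfm hmeas]
    _ ≤ ∫⁻ u, f u := setLIntegral_le_lintegral _ _
    _ = ∫⁻ u in Ioi (tail ν t).toReal, ENNReal.ofReal u ^ r := by
        rw [hf, lintegral_indicator measurableSet_Ici]
        exact setLIntegral_congr Ioi_ae_eq_Ici.symm
    _ = _ := by rw [lintegral_Ioi_ofReal_rpow hr hFt, ENNReal.ofReal_toReal (hfin t ht).ne]

/-- The `1/p`-th power of a decreasing function `∫_x^∞ g dm` lies below a primitive `∫_x^∞ φ dν`,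
with `‖φ‖_{p,ν}^p` controlled by `∫ g F^(1-p) dm`, where `F` is the tail of `ν`. -/
theorem exists_rpow_setLIntegral_Ioi_le {ν m : Measure ℝ} [SFinite ν] [SFinite m]
    [NullSingletonClass ν] {p : ℝ} (hp : 1 < p) (hfin : ∀ x, 0 < x → tail ν x < ∞)
    (hpos : ∀ x, 0 < x → 0 < tail ν x) {g : ℝ → ℝ≥0∞} (hg : Measurable g) :
    ∃ φ : ℝ → ℝ≥0∞, Measurable φ ∧
      (∀ x, 0 < x → (∫⁻ t in Ioi x, g t ∂m) ^ (1 / p) ≤ ∫⁻ y in Ioi x, φ y ∂ν) ∧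
      ∫⁻ y in Ioi 0, φ y ^ p ∂ν ≤
        ENNReal.ofReal (1 / (p - 1) + 1) * ∫⁻ t in Ioi 0, g t * tail ν t ^ (1 - p) ∂m := by
  have hp0 : 0 < p := by linarith
  have hF := measurable_tail_s1 ν
  have hanti : ∀ {x y : ℝ}, x ≤ y → tail ν x ^ (-p) ≤ tail ν y ^ (-p) := fun hxy => by
    rw [ENNReal.rpow_neg, ENNReal.rpow_neg, ENNReal.inv_le_inv]
    exact ENNReal.rpow_le_rpow (tail_anti ν hxy) hp0.le
  have hk : Measurable fun z : ℝ × ℝ => g z.2 * tail ν (min z.2 z.1) ^ (-p) :=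
    (hg.comp measurable_snd).mul
      ((hF.comp (measurable_snd.min measurable_fst)).pow_const _)
  have hφ : Measurable fun y => ∫⁻ t in Ioi 0, g t * tail ν (min t y) ^ (-p) ∂m :=
    hk.lintegral_prod_right'
  refine ⟨fun y => (∫⁻ t in Ioi 0, g t * tail ν (min t y) ^ (-p) ∂m) ^ (1 / p),
    hφ.pow_const _, fun x hx => ?_, ?_⟩
  · calc (∫⁻ t in Ioi x, g t ∂m) ^ (1 / p)
        = ∫⁻ y in Ioi x, ((∫⁻ t in Ioi x, g t ∂m) * tail ν x ^ (-p)) ^ (1 / p) ∂ν := by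
          rw [lintegral_const, Measure.restrict_apply MeasurableSet.univ, univ_inter, ← tail,
            ENNReal.mul_rpow_of_nonneg _ _ (by positivity), ← ENNReal.rpow_mul,
            show -p * (1 / p) = -1 by field_simp, ENNReal.rpow_neg_one, mul_assoc,
            ENNReal.inv_mul_cancel (hpos x hx).ne' (hfin x hx).ne, mul_one]
      _ ≤ _ := by
          refine setLIntegral_mono (hφ.pow_const _) fun y hy => ?_
          refine ENNReal.rpow_le_rpow ?_ (by positivity)
          rw [← lintegral_mul_const _ hg]
          refine (setLIntegral_mono' measurableSet_Ioi fun t ht => ?_).trans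
            (lintegral_mono_set (Ioi_subset_Ioi hx.le))
          exact mul_le_mul_right (hanti (le_min (le_of_lt ht) (le_of_lt hy))) _
  · simp only [← ENNReal.rpow_mul, one_div_mul_cancel hp0.ne', ENNReal.rpow_one]
    rw [lintegral_lintegral_swap hk.aemeasurable, ← lintegral_const_mul _ (by fun_prop)]
    refine setLIntegral_mono' measurableSet_Ioi fun t ht => ?_
    have ht : 0 < t := ht
    rw [lintegral_const_mul _ (by fun_prop), mul_left_comm]
    gcongr
    rw [← Ioc_union_Ioi_eq_Ioi ht.le]
    refine (lintegral_union_le _ _ _).trans ?_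
    rw [ENNReal.ofReal_add (by
      have : 0 < p - 1 := by linarith
      positivity) zero_le_one, add_mul]
    refine add_le_add ?_ ?_
    · rw [setLIntegral_congr_fun measurableSet_Ioc
        (g := fun y => tail ν y ^ (-p)) fun y hy => by simp only [min_eq_right hy.2]]
      refine (lintegral_Ioc_tail_rpow_le hfin hpos (by linarith) ht).trans_eq ?_
      rw [neg_neg, neg_add_eq_sub]
    · rw [setLIntegral_congr_fun measurableSet_Ioi
        (g := fun y => tail ν t ^ (-p)) fun y hy => by
          simp only [min_eq_left (le_of_lt (mem_Ioi.1 hy))]]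
      rw [lintegral_const, Measure.restrict_apply MeasurableSet.univ, univ_inter, ← tail,
        ENNReal.ofReal_one, one_mul, sub_eq_neg_add,
        ENNReal.rpow_add _ _ (hpos t ht).ne' (hfin t ht).ne, ENNReal.rpow_one]

/-- A weighted Hölder inequality on `(x, ∞)`, with powers of the tail of `ν` as weights. -/
theorem setLIntegral_Ioi_rpow_le {ν : Measure ℝ} [NullSingletonClass ν] {p b : ℝ} (hb : 0 < b)
    (hbp : p = 2 * b + 1) (hfin : ∀ x, 0 < x → tail ν x < ∞) (hpos : ∀ x, 0 < x → 0 < tail ν x)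
    {φ : ℝ → ℝ≥0∞} (hφ : Measurable φ) {x : ℝ} (hx : 0 < x) :
    (∫⁻ y in Ioi x, φ y ∂ν) ^ p ≤
      2 ^ (2 * b) * ((∫⁻ t in Ioi x, φ t ^ p * tail ν t ^ b ∂ν) * tail ν x ^ b) := by
  have hp : 1 < p := by linarith
  have hp0 : 0 < p := by linarith
  have hpq : p.HolderConjugate (p / (p - 1)) := Real.HolderConjugate.conjExponent hp
  set a := b / p with ha
  have h := ENNReal.lintegral_mul_le_Lp_mul_Lq (ν.restrict (Ioi x)) hpq
    (f := fun y => φ y * tail ν y ^ a) (g := fun y => tail ν y ^ (-a))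
    (by fun_prop) (by fun_prop)
  have h1 : ∫⁻ y in Ioi x, ((fun y => φ y * tail ν y ^ a) * fun y => tail ν y ^ (-a)) y ∂ν =
      ∫⁻ y in Ioi x, φ y ∂ν := by
    refine setLIntegral_congr_fun measurableSet_Ioi fun y hy => ?_
    simp only [Pi.mul_apply]
    rw [mul_assoc, ← ENNReal.rpow_add _ _ (hpos y (hx.trans hy)).ne' (hfin y (hx.trans hy)).ne,
      add_neg_cancel, ENNReal.rpow_zero, mul_one]
  have h2 : ∫⁻ y in Ioi x, (φ y * tail ν y ^ a) ^ p ∂ν =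
      ∫⁻ y in Ioi x, φ y ^ p * tail ν y ^ b ∂ν := by
    refine lintegral_congr fun y => ?_
    rw [ENNReal.mul_rpow_of_nonneg _ _ hp0.le, ← ENNReal.rpow_mul, ha,
      div_mul_cancel₀ _ hp0.ne']
  have h3 : ∫⁻ y in Ioi x, (tail ν y ^ (-a)) ^ (p / (p - 1)) ∂ν =
      2 * tail ν x ^ (1 / 2 : ℝ) := by
    have he : -a * (p / (p - 1)) = -(1 / 2) := by
      have : p - 1 ≠ 0 := by linarith
      rw [ha]
      field_simp
      linarith
    simp only [← ENNReal.rpow_mul, he]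
    rw [lintegral_Ioi_tail_rpow (hfin x hx) (fun y hy => hpos y (hx.trans_le hy))
      (by norm_num)]
    norm_num
  rw [h1, h2, h3] at h
  refine (ENNReal.rpow_le_rpow h hp0.le).trans_eq ?_
  have he : 1 / (p / (p - 1)) * p = 2 * b := by
    have : p - 1 ≠ 0 := by linarith
    field_simp
    linarith
  rw [ENNReal.mul_rpow_of_nonneg _ _ hp0.le, ← ENNReal.rpow_mul, ← ENNReal.rpow_mul, he,
    one_div_mul_cancel hp0.ne', ENNReal.rpow_one, ENNReal.mul_rpow_of_nonneg _ _ (by positivity),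
    ← ENNReal.rpow_mul, show 1 / 2 * (2 * b) = b by ring, mul_left_comm]

/-- The `p`-th power of a primitive `∫_x^∞ φ dν` lies below a primitive `∫_x^∞ γ dν`, with
`∫ γ F^(1-p) dν` controlled by `‖φ‖_{p,ν}^p`, where `F` is the tail of `ν`. -/
theorem exists_setLIntegral_Ioi_rpow_le {ν : Measure ℝ} [SFinite ν] [NullSingletonClass ν] {p : ℝ}
    (hp : 1 < p) (hfin : ∀ x, 0 < x → tail ν x < ∞) (hpos : ∀ x, 0 < x → 0 < tail ν x)
    {φ : ℝ → ℝ≥0∞} (hφ : Measurable φ) :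
    ∃ γ : ℝ → ℝ≥0∞, Measurable γ ∧
      (∀ x, 0 < x → (∫⁻ y in Ioi x, φ y ∂ν) ^ p ≤ ∫⁻ y in Ioi x, γ y ∂ν) ∧
      ∫⁻ y in Ioi 0, γ y * tail ν y ^ (1 - p) ∂ν ≤
        2 ^ p * ∫⁻ y in Ioi 0, φ y ^ p ∂ν := by
  have hF := measurable_tail_s1 ν
  obtain ⟨b, hb, hbp⟩ : ∃ b : ℝ, 0 < b ∧ p = 2 * b + 1 := ⟨(p - 1) / 2, by linarith, by ring⟩
  have hp0 : 0 < p := by linarith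
  have hmulpow : ∀ {x : ℝ} (r s : ℝ), 0 < x →
      tail ν x ^ r * tail ν x ^ s = tail ν x ^ (r + s) := fun r s hx =>
    (ENNReal.rpow_add _ _ (hpos _ hx).ne' (hfin _ hx).ne).symm
  set ψ : ℝ → ℝ≥0∞ := fun t => φ t ^ p * tail ν t ^ b with hψ
  have hψm : Measurable ψ := by fun_prop
  set k : ℝ → ℝ → ℝ≥0∞ := fun s t =>
    (Iic t).indicator (fun s => ψ t * (ENNReal.ofReal b * tail ν s ^ (b - 1))) s with hk
  have hkm : Measurable (Function.uncurry k) := by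
    have : Function.uncurry k = {z : ℝ × ℝ | z.1 ≤ z.2}.indicator
        fun z => ψ z.2 * (ENNReal.ofReal b * tail ν z.1 ^ (b - 1)) := by
      ext ⟨s, t⟩
      simp [hk, indicator_apply]
    rw [this]
    refine Measurable.indicator ?_ (measurableSet_le measurable_fst measurable_snd)
    exact (hψm.comp measurable_snd).mul
      (((hF.comp measurable_fst).pow_const _).const_mul _)
  have hkI : Measurable fun s => ∫⁻ t in Ioi 0, k s t ∂ν := hkm.lintegral_prod_right'
  refine ⟨fun y => 2 ^ (2 * b) * ((∫⁻ t in Ioi 0, k y t ∂ν) + ψ y * tail ν y ^ b), by fun_prop,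
    fun x hx => (setLIntegral_Ioi_rpow_le hb hbp hfin hpos hφ hx).trans ?_, ?_⟩
  · rw [lintegral_const_mul _ (by fun_prop), lintegral_add_left hkI,
      lintegral_lintegral_swap hkm.aemeasurable]
    gcongr
    rw [← lintegral_mul_const _ hψm]
    refine le_trans ?_ (add_le_add_left (lintegral_mono_set (Ioi_subset_Ioi hx.le)) _)
    rw [← lintegral_add_right _ (by fun_prop)]
    refine setLIntegral_mono' measurableSet_Ioi fun t ht => ?_
    have ht0 : 0 < t := hx.trans ht
    have hr : ∀ {z : ℝ}, 0 < z →
        tail ν z ^ b = ∫⁻ s in Ioi z, ENNReal.ofReal b * tail ν s ^ (b - 1) ∂ν := by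
      intro z hz
      rw [lintegral_const_mul _ (by fun_prop),
        lintegral_Ioi_tail_rpow (hfin z hz) (fun y hy => hpos y (hz.trans_le hy))
          (by linarith), sub_add_cancel, ← mul_assoc, ← ENNReal.ofReal_mul hb.le,
        mul_one_div_cancel hb.ne', ENNReal.ofReal_one, one_mul]
    have hk1 : ∫⁻ s in Ioi x, k s t ∂ν =
        ψ t * ∫⁻ s in Ioc x t, ENNReal.ofReal b * tail ν s ^ (b - 1) ∂ν := by
      rw [lintegral_indicator measurableSet_Iic, Measure.restrict_restrict measurableSet_Iic,
        lintegral_const_mul _ (by fun_prop), inter_comm, Ioi_inter_Iic]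
    rw [hk1, ← mul_add]
    gcongr
    rw [hr hx, hr ht0, ← Ioc_union_Ioi_eq_Ioi (le_of_lt ht)]
    exact lintegral_union_le _ _ _
  · simp only [mul_assoc]
    have h2 : (2 : ℝ≥0∞) ^ p = 2 ^ (2 * b) * 2 := by
      rw [hbp, ENNReal.rpow_add _ _ (by simp) (by simp), ENNReal.rpow_one]
    rw [lintegral_const_mul _ (by fun_prop), h2, mul_assoc]
    gcongr
    simp only [add_mul]
    rw [lintegral_add_left (by fun_prop), two_mul]
    refine add_le_add ?_ (le_of_eq ?_)
    · simp only [← lintegral_mul_const _ hkm.of_uncurry_left]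
      rw [lintegral_lintegral_swap (by fun_prop)]
      refine setLIntegral_mono' measurableSet_Ioi fun t ht => ?_
      have ht0 : 0 < t := ht
      have hk2 : ∫⁻ s in Ioi 0, k s t * tail ν s ^ (1 - p) ∂ν =
          ψ t * (ENNReal.ofReal b * ∫⁻ s in Ioc 0 t, tail ν s ^ (b - p) ∂ν) := by
        rw [← lintegral_const_mul _ (by fun_prop), ← lintegral_const_mul _ (by fun_prop),
          ← Ioi_inter_Iic, inter_comm, ← Measure.restrict_restrict measurableSet_Iic,
          ← lintegral_indicator measurableSet_Iic]
        refine setLIntegral_congr_fun measurableSet_Ioi fun s hs => ?_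
        by_cases hst : s ∈ Iic t
        · have hpow := hmulpow (b - 1) (1 - p) hs
          rw [show b - 1 + (1 - p) = b - p by ring] at hpow
          simp only [hk, indicator_of_mem hst, ← hpow]
          ring
        · simp only [hk, indicator_of_notMem hst, zero_mul]
      rw [hk2]
      have hle := lintegral_Ioc_tail_rpow_le (r := b - p) hfin hpos (by linarith) ht0
      calc _ ≤ ψ t * (ENNReal.ofReal b *
            (ENNReal.ofReal (1 / (-(b - p) - 1)) * tail ν t ^ (b - p + 1))) := by gcongr
        _ = φ t ^ p := by
          rw [← mul_assoc (ENNReal.ofReal b), ← ENNReal.ofReal_mul hb.le,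
            show -(b - p) - 1 = b by linarith, mul_one_div_cancel hb.ne', ENNReal.ofReal_one,
            one_mul, hψ]
          simp only
          rw [mul_assoc, hmulpow _ _ ht0, show b + (b - p + 1) = 0 by linarith,
            ENNReal.rpow_zero, mul_one]
    · refine setLIntegral_congr_fun measurableSet_Ioi fun t ht => ?_
      simp only [hψ, mul_assoc]
      rw [hmulpow _ _ ht, hmulpow _ _ ht, show b + (b + (1 - p)) = 0 by linarith,
        ENNReal.rpow_zero, mul_one]

theorem wnorm_le_const_mul {q : ℝ} (hq : 0 < q) {w f g : ℝ → ℝ≥0∞} {C : ℝ≥0} (hw : Measurable w)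
    (hg : Measurable g) (hfg : ∀ᵐ x ∂mu0, f x ≤ C * g x) :
    wnorm q w f ≤ C * wnorm q w g := by
  have h : ∫⁻ x in Ioi (0 : ℝ), f x ^ q * w x ≤
      (C : ℝ≥0∞) ^ q * ∫⁻ x in Ioi (0 : ℝ), g x ^ q * w x := by
    rw [← lintegral_const_mul _ (by fun_prop)]
    refine lintegral_mono_ae ?_
    filter_upwards [hfg] with x hx
    rw [← mul_assoc, ← ENNReal.mul_rpow_of_nonneg _ _ hq.le]
    gcongr
  refine (ENNReal.rpow_le_rpow h (by positivity)).trans_eq ?_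
  rw [ENNReal.mul_rpow_of_nonneg _ _ (by positivity), ← ENNReal.rpow_mul,
    mul_one_div_cancel hq.ne', ENNReal.rpow_one, wnorm]

theorem Psi_rpow {p : ℝ} (hp : 1 < p) (v : ℝ → ℝ≥0∞) (x : ℝ) :
    Psi p v x ^ (1 - 2 * p) = (∫⁻ t in Ioi x, v t ^ (1 - p / (p - 1))) ^ (1 - p) := by
  rw [Psi, ← ENNReal.rpow_mul]
  congr 1
  have h1 : p - 1 ≠ 0 := by linarith
  have h2 : p + (p - 1) ≠ 0 := by linarith
  field_simp
  ring

theorem setLIntegral_Ioi_withDensity {σ : ℝ → ℝ≥0∞} (hσ : Measurable σ) {f : ℝ → ℝ≥0∞}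
    (hf : Measurable f) {x : ℝ} (hx : 0 ≤ x) :
    ∫⁻ t in Ioi x, f t ∂mu0.withDensity σ = ∫⁻ t in Ioi x, σ t * f t := by
  rw [restrict_withDensity measurableSet_Ioi, lintegral_withDensity_eq_lintegral_mul _ hσ hf, mu0,
    Measure.restrict_restrict measurableSet_Ioi, inter_eq_left.2 (Ioi_subset_Ioi hx)]
  rfl

theorem tail_withDensity {σ : ℝ → ℝ≥0∞} (hσ : Measurable σ) {x : ℝ} (hx : 0 ≤ x) :
    tail (mu0.withDensity σ) x = ∫⁻ t in Ioi x, σ t := by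
  simpa [tail] using setLIntegral_Ioi_withDensity hσ (f := fun _ => 1) measurable_const hx

theorem setLIntegral_Ioi_pos {σ : ℝ → ℝ≥0∞} (hσ : Measurable σ) (hpos : ∀ᵐ x ∂mu0, 0 < σ x) {x : ℝ}
    (hx : 0 ≤ x) : 0 < ∫⁻ t in Ioi x, σ t := by
  refine pos_iff_ne_zero.2 fun h => ?_
  rw [lintegral_eq_zero_iff hσ] at h
  have hpos' := ae_mono (Measure.restrict_mono (Ioi_subset_Ioi hx) le_rfl) hpos
  have hfalse : ∀ᵐ t ∂volume.restrict (Ioi x), False := by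
    filter_upwards [h, hpos'] with t h1 h2
    exact h2.ne' h1
  rw [ae_iff] at hfalse
  simp at hfalse

theorem IsWeight.rpow {v : ℝ → ℝ≥0∞} (hv : IsWeight v) (r : ℝ) :
    IsWeight fun t => v t ^ r := by
  refine ⟨hv.1.pow_const r, ?_⟩
  filter_upwards [hv.2] with x hx
  exact ⟨ENNReal.rpow_pos hx.1 hx.2.ne,
    lt_top_iff_ne_top.2 (ENNReal.rpow_ne_top_of_ne_zero hx.1.ne' hx.2.ne)⟩

/-- `(φ σ)^p v = σ φ^p` for the dual weight `σ = v^(1 - p')`. -/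
theorem mul_dual_rpow_mul {p : ℝ} (hp : 1 < p) {a : ℝ≥0∞} (h0 : a ≠ 0) (ht : a ≠ ∞) (b : ℝ≥0∞) :
    (a ^ (1 - p / (p - 1)) * b) ^ p * a = a ^ (1 - p / (p - 1)) * b ^ p := by
  have h1 : p - 1 ≠ 0 := by linarith
  rw [ENNReal.mul_rpow_of_nonneg _ _ (by linarith), ← ENNReal.rpow_mul, mul_right_comm]
  congr 1
  nth_rewrite 2 [← ENNReal.rpow_one a]
  rw [← ENNReal.rpow_add _ _ h0 ht]
  congr 1
  field_simp
  ring

theorem statement1 (p q : ℝ) (hq : 0 < q) (hp : 1 < p)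
    (T : (ℝ → ℝ≥0∞) → ℝ → ℝ≥0∞) (hT : IsMQL T)
    (w v : ℝ → ℝ≥0∞) (hw : IsWeight w) (hv : IsWeight v)
    (hvfin : ∀ x ∈ Ioi (0 : ℝ), (∫⁻ t in Ioi x, v t ^ (1 - p / (p - 1))) < ∞) :
    (∃ C : ℝ≥0, 0 < C ∧ ∀ h : ℝ → ℝ≥0∞, Measurable h →
        wnorm q w (T fun x => ∫⁻ t in Ioi x, h t) ≤ (C : ℝ≥0∞) * wnorm p v h) ↔
      (∃ C' : ℝ≥0, 0 < C' ∧ ∀ h : ℝ → ℝ≥0∞, Measurable h →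
        wnorm (q / p) w
            (fun x => T (fun y => (∫⁻ t in Ioi y, h t) ^ (1 / p)) x ^ p) ≤
          (C' : ℝ≥0∞) * wnorm 1 (fun t => Psi p v t ^ (1 - 2 * p)) h) := by
  have hp0 : 0 < p := by linarith
  have hp1 : 0 < p - 1 := by linarith
  obtain ⟨C₁, hC₁, hmono⟩ := hT.mono
  have hprim : ∀ h : ℝ → ℝ≥0∞, Measurable fun x => ∫⁻ t in Ioi x, h t := fun h =>
    Antitone.measurable fun _ _ hxy => lintegral_mono_set (Ioi_subset_Ioi hxy)
  set σ : ℝ → ℝ≥0∞ := fun t => v t ^ (1 - p / (p - 1)) with hσdef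
  have hσw : IsWeight σ := hv.rpow _
  have hσ : Measurable σ := hσw.1
  have hvm : Measurable v := hv.1
  have : SFinite mu0 := by unfold mu0; infer_instance
  have : NullSingletonClass mu0 := by unfold mu0; infer_instance
  set ν := mu0.withDensity σ
  have htail : ∀ x, 0 < x → tail ν x = ∫⁻ t in Ioi x, σ t := fun x hx =>
    tail_withDensity hσ hx.le
  have hfin : ∀ x, 0 < x → tail ν x < ∞ := fun x hx => htail x hx ▸ hvfin x hx
  have hpos : ∀ x, 0 < x → 0 < tail ν x := fun x hx => htail x hx ▸
    setLIntegral_Ioi_pos hσ (hσw.2.mono fun _ h => h.1) hx.le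
  have hPsi : ∀ g : ℝ → ℝ≥0∞, wnorm 1 (fun t => Psi p v t ^ (1 - 2 * p)) g =
      ∫⁻ t in Ioi 0, g t * tail ν t ^ (1 - p) := by
    intro g
    simp only [wnorm, ENNReal.rpow_one, div_one, Psi_rpow hp]
    exact setLIntegral_congr_fun measurableSet_Ioi fun t ht => by simp only [htail t ht, hσdef]
  have hdual : ∀ φ : ℝ → ℝ≥0∞, Measurable φ →
      wnorm p v (fun t => σ t * φ t) = (∫⁻ t in Ioi 0, φ t ^ p ∂ν) ^ (1 / p) := by
    intro φ hφ
    rw [wnorm, setLIntegral_Ioi_withDensity hσ (by fun_prop) le_rfl]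
    congr 1
    refine lintegral_congr_ae ?_
    filter_upwards [hv.2] with t ht
    exact mul_dual_rpow_mul hp ht.1.ne' ht.2.ne _
  constructor
  · rintro ⟨C, hC, hT1⟩
    set K : ℝ≥0 := (1 / (p - 1) + 1).toNNReal
    have hK : 0 < K := Real.toNNReal_pos.2 (by positivity)
    refine ⟨(C₁ * C) ^ p * K, by positivity, fun g hg => ?_⟩
    obtain ⟨φ, hφ, hle, hint⟩ := exists_rpow_setLIntegral_Ioi_le (m := volume) hp hfin hpos hg
    have hTle : ∀ᵐ x ∂mu0, T (fun y => (∫⁻ t in Ioi y, g t) ^ (1 / p)) x ≤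
        C₁ * T (fun y => ∫⁻ t in Ioi y, σ t * φ t) x := by
      refine hmono _ _ ((hprim g).pow_const _) (hprim _) ?_
      refine (ae_restrict_iff' measurableSet_Ioi).2 (ae_of_all _ fun x hx => ?_)
      exact (hle x hx).trans_eq (setLIntegral_Ioi_withDensity hσ hφ (le_of_lt hx))
    have h1 := (wnorm_le_const_mul hq hw.1 (hT.measurable_map _ (hprim _)) hTle).trans
      (mul_le_mul_right (hT1 (fun t => σ t * φ t) (hσ.mul hφ)) _)
    rw [wnorm_div_rpow hp0, hPsi]
    refine (ENNReal.rpow_le_rpow h1 hp0.le).trans ?_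
    rw [hdual φ hφ, ← mul_assoc, ENNReal.mul_rpow_of_nonneg _ _ hp0.le, ← ENNReal.rpow_mul,
      one_div_mul_cancel hp0.ne', ENNReal.rpow_one, ENNReal.coe_mul,
      ENNReal.coe_rpow_of_nonneg _ hp0.le, ENNReal.coe_mul, mul_assoc]
    gcongr
    exact hint
  · rintro ⟨C, hC, hT2⟩
    refine ⟨C₁ * (C * 2 ^ p) ^ (1 / p), by positivity, fun h hh => ?_⟩
    set φ : ℝ → ℝ≥0∞ := fun t => (σ t)⁻¹ * h t with hφdef
    have hφ : Measurable φ := hσ.inv.mul hh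
    have hσφ : ∀ᵐ t ∂mu0, σ t * φ t = h t := by
      filter_upwards [hσw.2] with t ht
      rw [hφdef, ← mul_assoc, ENNReal.mul_inv_cancel ht.1.ne' ht.2.ne, one_mul]
    obtain ⟨γ, hγ, hle, hint⟩ := exists_setLIntegral_Ioi_rpow_le hp hfin hpos hφ
    have hTle : ∀ᵐ x ∂mu0, T (fun y => ∫⁻ t in Ioi y, h t) x ≤
        C₁ * T (fun y => (∫⁻ t in Ioi y, σ t * γ t) ^ (1 / p)) x := by
      refine hmono _ _ (hprim h) ((hprim _).pow_const _) ?_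
      refine (ae_restrict_iff' measurableSet_Ioi).2 (ae_of_all _ fun x hx => ?_)
      have hx0 : 0 ≤ x := le_of_lt hx
      have hh : ∫⁻ t in Ioi x, h t = ∫⁻ t in Ioi x, φ t ∂ν := by
        rw [setLIntegral_Ioi_withDensity hσ hφ hx0]
        refine lintegral_congr_ae ?_
        filter_upwards [ae_mono (Measure.restrict_mono (Ioi_subset_Ioi hx0) le_rfl) hσφ] with t ht
        exact ht.symm
      rw [hh, ← setLIntegral_Ioi_withDensity hσ hγ hx0, one_div, ENNReal.le_rpow_inv_iff hp0]
      exact hle x hx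
    have h2 := hT2 (fun t => σ t * γ t) (hσ.mul hγ)
    have hnorm : wnorm p v h = wnorm p v fun t => σ t * φ t := by
      rw [wnorm, wnorm]
      congr 1
      refine lintegral_congr_ae ?_
      filter_upwards [hσφ] with t ht
      rw [ht]
    have hγint : ∫⁻ t in Ioi 0, (σ t * γ t) * tail ν t ^ (1 - p) ≤
        2 ^ p * ∫⁻ t in Ioi 0, φ t ^ p ∂ν := by
      simp only [mul_assoc]
      rwa [← setLIntegral_Ioi_withDensity hσ (by fun_prop) le_rfl]
    rw [wnorm_div_rpow hp0, hPsi, ← ENNReal.le_rpow_inv_iff hp0] at h2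
    refine (wnorm_le_const_mul hq hw.1
      (hT.measurable_map _ ((hprim _).pow_const _)) hTle).trans ?_
    rw [hnorm, hdual φ hφ, ENNReal.coe_mul, mul_assoc]
    refine mul_le_mul_right (h2.trans ?_) _
    rw [ENNReal.coe_rpow_of_nonneg _ (by positivity), ← ENNReal.mul_rpow_of_nonneg _ _
      (by positivity), one_div]
    refine ENNReal.rpow_le_rpow ?_ (by positivity)
    rw [ENNReal.coe_mul, ENNReal.coe_rpow_of_nonneg _ hp0.le, mul_assoc]
    exact mul_le_mul_right hγint _
end
end

section
/- Let 0 < q < ∞, 0 < α < ∞, let w, v be weights on (0,∞), and let T be a monotone quasilinear operator on M⁺(0,∞). Set V(x) := ∫₀^x v(t) dt. Then there exists a constant C > 0 such that ‖Tf‖_{q,w,(0,∞)} ≤ C ‖f‖_{1,v,(0,∞)} for all nonincreasing f ∈ M⁺(0,∞) if and only if there exists a constant C' > 0 such that ‖T(x ↦ V(x)^{-(α+1)} ∫₀^x h(t) V(t)^α dt)‖_{q,w,(0,∞)} ≤ C' ∫₀^∞ h(t) dt for all h ∈ M⁺(0,∞). -/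
open MeasureTheory Set ENNReal NNReal

noncomputable section

/-- The primitive `V(x) = ∫₀ˣ v`. -/
def primitive (v : ℝ → ℝ≥0∞) (x : ℝ) : ℝ≥0∞ := ∫⁻ t in Ioc (0 : ℝ) x, v t

lemma primitive_mono (v : ℝ → ℝ≥0∞) : Monotone (primitive v) := fun _ _ hxy =>
  lintegral_mono_set (Ioc_subset_Ioc_right hxy)

lemma measurable_primitive (v : ℝ → ℝ≥0∞) : Measurable (primitive v) :=
  (primitive_mono v).measurable

lemma primitive_pos {v : ℝ → ℝ≥0∞} (hv : IsWeight v) {x : ℝ} (hx : 0 < x) :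
    0 < primitive v x := by
  have hpos : ∀ᵐ t ∂volume.restrict (Ioc (0 : ℝ) x), 0 < v t :=
    (ae_restrict_of_ae_restrict_of_subset Ioc_subset_Ioi_self hv.2).mono fun _ h => h.1
  rw [pos_iff_ne_zero, primitive, Ne, lintegral_eq_zero_iff hv.1]
  intro h0
  have hfalse : ∀ᵐ t ∂volume.restrict (Ioc (0 : ℝ) x), False := by
    filter_upwards [hpos, h0] with t h1 h2
    exact h1.ne' h2
  rw [ae_iff] at hfalse
  simp at hfalse
  exact absurd hfalse (not_le.2 hx)

/-- The measure `v(t) dt` of a strict sublevel set of its own primitive is at most the level. -/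
lemma setLIntegral_primitive_lt_le (v : ℝ → ℝ≥0∞) (s : ℝ≥0∞) :
    ∫⁻ x in {x | 0 < x ∧ primitive v x < s}, v x ≤ s := by
  by_cases hmax : ∃ m, IsGreatest {x | 0 < x ∧ primitive v x < s} m
  · obtain ⟨m, hm, hub⟩ := hmax
    have hsub : {x | 0 < x ∧ primitive v x < s} ⊆ Ioc (0 : ℝ) m := fun x hx => ⟨hx.1, hub hx⟩
    exact (lintegral_mono_set hsub).trans hm.2.le
  · have hsub : {x | 0 < x ∧ primitive v x < s} ⊆
        ⋃ r : {r : ℚ // primitive v r < s}, Ioc (0 : ℝ) (r : ℚ) := by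
      intro x hx
      obtain ⟨y, hy, hxy⟩ : ∃ y ∈ {x | 0 < x ∧ primitive v x < s}, x < y := by
        by_contra! h
        exact hmax ⟨x, hx, h⟩
      obtain ⟨r, hxr, hry⟩ := exists_rat_btwn hxy
      exact mem_iUnion.2 ⟨⟨r, (primitive_mono v hry.le).trans_lt hy.2⟩, hx.1, hxr.le⟩
    have hdir : Directed (· ⊆ ·) fun r : {r : ℚ // primitive v r < s} =>
        Ioc (0 : ℝ) (r : ℚ) := by
      have hmono : Monotone fun r : {r : ℚ // primitive v r < s} => Ioc (0 : ℝ) (r : ℚ) :=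
        fun a b hab => Ioc_subset_Ioc_right (Rat.cast_le.2 hab)
      exact hmono.directed_le
    refine (lintegral_mono_set hsub).trans ?_
    rw [setLIntegral_iUnion_of_directed _ hdir]
    exact iSup_le fun r => r.2.le

/-- Lower bound for the integral of `V ^ α` against its own derivative. -/
lemma primitive_rpow_le_setLIntegral {v : ℝ → ℝ≥0∞} (hv : Measurable v) {α : ℝ} (hα : 0 < α)
    {x : ℝ} (hfin : primitive v x ≠ ∞) :
    primitive v x ^ (α + 1) ≤
      2 ^ (α + 1) * ∫⁻ t in Ioc (0 : ℝ) x, v t * primitive v t ^ α := by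
  set A : Set ℝ := {t | 0 < t ∧ primitive v t < primitive v x / 2}
  have hA : MeasurableSet A :=
    measurableSet_Ioi.inter (measurableSet_lt (measurable_primitive v) measurable_const)
  have hhalf : primitive v x / 2 ≤ ∫⁻ t in Ioc (0 : ℝ) x \ A, v t := by
    have hle : primitive v x ≤ primitive v x / 2 + ∫⁻ t in Ioc (0 : ℝ) x \ A, v t :=
      calc primitive v x ≤ ∫⁻ t in A ∪ (Ioc (0 : ℝ) x \ A), v t :=
            lintegral_mono_set (by rw [union_sdiff_self]; exact subset_union_right)
        _ ≤ (∫⁻ t in A, v t) + ∫⁻ t in Ioc (0 : ℝ) x \ A, v t := lintegral_union_le _ _ _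
        _ ≤ _ := by gcongr; exact setLIntegral_primitive_lt_le v _
    have hfin' : primitive v x / 2 ≠ ∞ := ENNReal.div_ne_top hfin two_ne_zero
    nth_rewrite 1 [← ENNReal.add_halves (primitive v x)] at hle
    exact (ENNReal.add_le_add_iff_left hfin').1 hle
  have hint : (primitive v x / 2) ^ (α + 1) ≤
      ∫⁻ t in Ioc (0 : ℝ) x, v t * primitive v t ^ α :=
    calc (primitive v x / 2) ^ (α + 1)
        = primitive v x / 2 * (primitive v x / 2) ^ α := by
          rw [ENNReal.rpow_add_of_nonneg _ _ hα.le zero_le_one, ENNReal.rpow_one, mul_comm]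
      _ ≤ (∫⁻ t in Ioc (0 : ℝ) x \ A, v t) * (primitive v x / 2) ^ α := by gcongr
      _ = ∫⁻ t in Ioc (0 : ℝ) x \ A, v t * (primitive v x / 2) ^ α :=
          (lintegral_mul_const _ hv).symm
      _ ≤ ∫⁻ t in Ioc (0 : ℝ) x \ A, v t * primitive v t ^ α := by
          refine setLIntegral_mono' (measurableSet_Ioc.diff hA) fun t ht => ?_
          have : primitive v x / 2 ≤ primitive v t :=
            not_lt.1 fun h => ht.2 ⟨ht.1.1, h⟩
          gcongr
      _ ≤ _ := lintegral_mono_set sdiff_subset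
  calc primitive v x ^ (α + 1) = 2 ^ (α + 1) * (primitive v x / 2) ^ (α + 1) := by
        rw [← ENNReal.mul_rpow_of_nonneg _ _ (by positivity),
          ENNReal.mul_div_cancel two_ne_zero ofNat_ne_top]
    _ ≤ _ := by gcongr

/-- A constant, finite for `α > 0`, in the kernel estimate `kernel_estimate`. -/
def kernelConst (α : ℝ) : ℝ≥0∞ := 2 * ∑' k : ℕ, ((2 : ℝ≥0∞) ^ (-α)) ^ k

lemma kernelConst_ne_top {α : ℝ} (hα : 0 < α) : kernelConst α ≠ ∞ := by
  have hlt : (2 : ℝ≥0∞) ^ (-α) < 1 :=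
    ENNReal.rpow_lt_one_of_one_lt_of_neg one_lt_two (neg_lt_zero.2 hα)
  rw [kernelConst, ENNReal.tsum_geometric]
  exact ENNReal.mul_ne_top ofNat_ne_top (ENNReal.inv_ne_top.2 (tsub_pos_of_lt hlt).ne')

/-- Dyadic domination of `b ^ (-(α + 1))` at the scale `a ≤ b`. -/
lemma rpow_neg_le_tsum_dyadic {a b : ℝ≥0∞} (ha : a ≠ 0) (hab : a ≤ b) (hb : b ≠ ∞) {α : ℝ}
    (hα : 0 < α) :
    b ^ (-(α + 1)) ≤ ∑' k : ℕ, if b < 2 ^ (k + 1) * a then (2 ^ k * a) ^ (-(α + 1)) else 0 := by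
  have haf : a ≠ ∞ := ne_top_of_le_ne_top hb hab
  have hex : ∃ k : ℕ, b < 2 ^ (k + 1) * a := by
    obtain ⟨n, hn⟩ := ENNReal.exists_nat_mul_gt ha hb
    refine ⟨n, hn.trans_le ?_⟩
    gcongr
    exact_mod_cast (Nat.lt_two_pow_self.le.trans (Nat.pow_le_pow_right two_pos n.le_succ))
  classical
  have hspec := Nat.find_spec hex
  have hle : 2 ^ Nat.find hex * a ≤ b := by
    rcases hk : Nat.find hex with _ | k
    · simpa using hab
    · exact not_lt.1 (Nat.find_min hex (m := k) (by omega))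
  refine le_trans ?_ (ENNReal.le_tsum (Nat.find hex))
  rw [if_pos hspec, ENNReal.rpow_neg, ENNReal.rpow_neg]
  gcongr

lemma kernel_estimate {v : ℝ → ℝ≥0∞} (hv : Measurable v) {α : ℝ} (hα : 0 < α) (t : ℝ) :
    primitive v t ^ α * ∫⁻ x in Ioi (0 : ℝ), primitive v (max t x) ^ (-(α + 1)) * v x ≤
      kernelConst α := by
  set a := primitive v t with ha
  have hneg : -(α + 1) < 0 := by linarith
  rcases eq_or_ne a 0 with h0 | h0
  · rw [h0, ENNReal.zero_rpow_of_pos hα, zero_mul]; exact zero_le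
  rcases eq_or_ne a ∞ with htop | htop
  · have : ∀ x, primitive v (max t x) = ∞ := fun x =>
      top_le_iff.1 (htop ▸ primitive_mono v (le_max_left t x))
    simp only [this, ENNReal.top_rpow_of_neg hneg, zero_mul, lintegral_zero, mul_zero, zero_le]
  set c : ℕ → ℝ≥0∞ := fun k => (2 ^ k * a) ^ (-(α + 1))
  set S : ℕ → Set ℝ := fun k => {x | 0 < x ∧ primitive v x < 2 ^ (k + 1) * a}
  have hS : ∀ k, MeasurableSet (S k) := fun k =>
    measurableSet_Ioi.inter (measurableSet_lt (measurable_primitive v) measurable_const)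
  have hdom : ∀ x ∈ Ioi (0 : ℝ), primitive v (max t x) ^ (-(α + 1)) * v x ≤
      ∑' k, c k * (S k).indicator v x := by
    intro x hx
    rcases eq_or_ne (primitive v (max t x)) ∞ with hb | hb
    · simp only [hb, ENNReal.top_rpow_of_neg hneg, zero_mul, zero_le]
    refine (mul_le_mul_left (rpow_neg_le_tsum_dyadic h0
      (primitive_mono v (le_max_left t x)) hb hα) _).trans ?_
    rw [← ENNReal.tsum_mul_right]
    refine ENNReal.tsum_le_tsum fun k => ?_
    split_ifs with h
    · have : x ∈ S k := ⟨hx, (primitive_mono v (le_max_right t x)).trans_lt h⟩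
      rw [indicator_of_mem this]
    · simp
  have hterm : ∀ k, c k * (2 ^ (k + 1) * a) = a ^ (-α) * (2 * ((2 : ℝ≥0∞) ^ (-α)) ^ k) := by
    intro k
    have h2k0 : (2 : ℝ≥0∞) ^ k ≠ 0 := pow_ne_zero _ two_ne_zero
    have h2kt : (2 : ℝ≥0∞) ^ k ≠ ∞ := ENNReal.pow_ne_top ofNat_ne_top
    have hb0 : 2 ^ k * a ≠ 0 := mul_ne_zero h2k0 h0
    have hbt : 2 ^ k * a ≠ ∞ := ENNReal.mul_ne_top h2kt htop
    calc c k * (2 ^ (k + 1) * a) = 2 * ((2 ^ k * a) ^ (-(α + 1)) * (2 ^ k * a) ^ (1 : ℝ)) := by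
          rw [ENNReal.rpow_one]; ring
      _ = 2 * (2 ^ k * a) ^ (-α) := by
          rw [← ENNReal.rpow_add _ _ hb0 hbt]; congr 2; ring
      _ = _ := by
          rw [ENNReal.mul_rpow_of_ne_top h2kt htop, ← ENNReal.rpow_natCast,
            ← ENNReal.rpow_natCast, ← ENNReal.rpow_mul, ← ENNReal.rpow_mul,
            mul_comm (k : ℝ) (-α)]
          ring
  have hbound : ∫⁻ x in Ioi (0 : ℝ), primitive v (max t x) ^ (-(α + 1)) * v x ≤
      a ^ (-α) * kernelConst α :=
    calc _ ≤ ∫⁻ x in Ioi (0 : ℝ), ∑' k, c k * (S k).indicator v x :=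
          setLIntegral_mono' measurableSet_Ioi hdom
      _ = ∑' k, c k * ∫⁻ x in Ioi (0 : ℝ), (S k).indicator v x := by
          rw [lintegral_tsum fun k => ((hv.indicator (hS k)).const_mul _).aemeasurable]
          exact tsum_congr fun k => lintegral_const_mul _ (hv.indicator (hS k))
      _ ≤ ∑' k, c k * (2 ^ (k + 1) * a) := by
          refine ENNReal.tsum_le_tsum fun k => ?_
          gcongr
          calc _ ≤ ∫⁻ x, (S k).indicator v x := setLIntegral_le_lintegral _ _
            _ = ∫⁻ x in S k, v x := lintegral_indicator (hS k) _
            _ ≤ _ := setLIntegral_primitive_lt_le v _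
      _ = a ^ (-α) * kernelConst α := by
          simp_rw [hterm, kernelConst, ENNReal.tsum_mul_left]
  calc _ ≤ a ^ α * (a ^ (-α) * kernelConst α) := by gcongr
    _ = kernelConst α := by
        rw [← mul_assoc, ← ENNReal.rpow_add _ _ h0 htop, add_neg_cancel, ENNReal.rpow_zero,
          one_mul]

/-- The averaging operator `h ↦ V(x) ^ (-(α + 1)) ∫₀ˣ h V ^ α`. -/
def hardyAvg (α : ℝ) (v h : ℝ → ℝ≥0∞) (x : ℝ) : ℝ≥0∞ :=
  primitive v x ^ (-(α + 1)) * ∫⁻ t in Ioc (0 : ℝ) x, h t * primitive v t ^ α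

/-- A nonincreasing majorant of `hardyAvg α v h`. -/
def hardyMajorant (α : ℝ) (v h : ℝ → ℝ≥0∞) (x : ℝ) : ℝ≥0∞ :=
  ∫⁻ t in Ioi (0 : ℝ), h t * primitive v t ^ α * primitive v (max t x) ^ (-(α + 1))

lemma measurable_hardyAvg (α : ℝ) (v h : ℝ → ℝ≥0∞) : Measurable (hardyAvg α v h) :=
  ((measurable_primitive v).pow_const _).mul
    (measurable_primitive fun t => h t * primitive v t ^ α)

lemma hardyMajorant_antitone {α : ℝ} (hα : 0 < α) (v h : ℝ → ℝ≥0∞) :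
    Antitone (hardyMajorant α v h) := by
  intro x y hxy
  refine lintegral_mono fun t => ?_
  have := primitive_mono v (max_le_max_left t hxy)
  have hα' : 0 ≤ α + 1 := by positivity
  simp only [ENNReal.rpow_neg]
  gcongr

lemma hardyAvg_le_hardyMajorant {α : ℝ} {v h : ℝ → ℝ≥0∞} (hh : Measurable h) (x : ℝ) :
    hardyAvg α v h x ≤ hardyMajorant α v h x := by
  have hV := measurable_primitive v
  rw [hardyAvg, mul_comm, ← lintegral_mul_const _ (by fun_prop)]
  calc _ = ∫⁻ t in Ioc (0 : ℝ) x, h t * primitive v t ^ α * primitive v (max t x) ^ (-(α + 1)) :=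
        setLIntegral_congr_fun measurableSet_Ioc fun t ht => by simp only [max_eq_right ht.2]
    _ ≤ _ := lintegral_mono_set Ioc_subset_Ioi_self

lemma lintegral_hardyMajorant_le {α : ℝ} (hα : 0 < α) {v h : ℝ → ℝ≥0∞} (hv : Measurable v)
    (hh : Measurable h) :
    ∫⁻ x in Ioi (0 : ℝ), hardyMajorant α v h x * v x ≤
      kernelConst α * ∫⁻ t in Ioi (0 : ℝ), h t := by
  have hV := measurable_primitive v
  calc ∫⁻ x in Ioi (0 : ℝ), hardyMajorant α v h x * v x
      = ∫⁻ x in Ioi (0 : ℝ), ∫⁻ t in Ioi (0 : ℝ),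
          h t * primitive v t ^ α * primitive v (max t x) ^ (-(α + 1)) * v x :=
        lintegral_congr fun x => (lintegral_mul_const _ (by fun_prop)).symm
    _ = ∫⁻ t in Ioi (0 : ℝ), ∫⁻ x in Ioi (0 : ℝ),
          h t * primitive v t ^ α * primitive v (max t x) ^ (-(α + 1)) * v x :=
        lintegral_lintegral_swap (by unfold Function.uncurry; fun_prop)
    _ = ∫⁻ t in Ioi (0 : ℝ), h t * (primitive v t ^ α *
          ∫⁻ x in Ioi (0 : ℝ), primitive v (max t x) ^ (-(α + 1)) * v x) := by
        refine lintegral_congr fun t => ?_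
        rw [← mul_assoc, ← lintegral_const_mul _ (by fun_prop)]
        simp only [mul_assoc]
    _ ≤ ∫⁻ t in Ioi (0 : ℝ), h t * kernelConst α :=
        lintegral_mono fun t => by gcongr; exact kernel_estimate hv hα t
    _ = _ := by rw [lintegral_mul_const _ hh, mul_comm]

/-- A nonincreasing function is dominated by the averaging operator applied to `f v`. -/
lemma le_hardyAvg {α : ℝ} (hα : 0 < α) {v f : ℝ → ℝ≥0∞} (hv : IsWeight v)
    (hanti : AntitoneOn f (Ioi (0 : ℝ)))
    (hfin : ∫⁻ t in Ioi (0 : ℝ), f t * v t ≠ ∞) {x : ℝ} (hx : 0 < x) :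
    f x ≤ hardyAvg α v (fun t => 2 ^ (α + 1) * (f t * v t)) x := by
  have hV := measurable_primitive v
  have hvm := hv.1
  have hle : ∀ t ∈ Ioc (0 : ℝ) x, f x ≤ f t := fun t ht => hanti ht.1 hx ht.2
  rcases eq_or_ne (primitive v x) ∞ with htop | htop
  · have hmul : f x * primitive v x ≤ ∫⁻ t in Ioi (0 : ℝ), f t * v t := by
      rw [primitive, ← lintegral_const_mul _ hvm]
      refine (setLIntegral_mono' measurableSet_Ioc fun t ht => ?_).trans
        (lintegral_mono_set Ioc_subset_Ioi_self)
      exact mul_le_mul_left (hle t ht) _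
    have hx0 : f x = 0 := by
      by_contra h0
      rw [htop, ENNReal.mul_top h0] at hmul
      exact hfin (top_le_iff.1 hmul)
    rw [hx0]; exact zero_le
  calc f x = primitive v x ^ (-(α + 1)) * (f x * primitive v x ^ (α + 1)) := by
        rw [mul_left_comm, ← ENNReal.rpow_add _ _ (primitive_pos hv hx).ne' htop,
          neg_add_cancel, ENNReal.rpow_zero, mul_one]
    _ ≤ primitive v x ^ (-(α + 1)) *
          (f x * (2 ^ (α + 1) * ∫⁻ t in Ioc (0 : ℝ) x, v t * primitive v t ^ α)) := by
        gcongr; exact primitive_rpow_le_setLIntegral hvm hα htop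
    _ ≤ _ := by
        rw [hardyAvg, ← mul_assoc (f x), ← lintegral_const_mul _ (by fun_prop)]
        gcongr _ * ?_
        refine setLIntegral_mono' measurableSet_Ioc fun t ht => ?_
        calc f x * 2 ^ (α + 1) * (v t * primitive v t ^ α)
            ≤ f t * 2 ^ (α + 1) * (v t * primitive v t ^ α) := by
              gcongr; exact hle t ht
          _ = _ := by ring

/-- Almost everywhere domination up to a constant passes to `wnorm`. -/
lemma wnorm_le_of_ae_le {q : ℝ} (hq : 0 < q) {w F G : ℝ → ℝ≥0∞} (hw : Measurable w)
    (hG : Measurable G) (C : ℝ≥0) (h : ∀ᵐ x ∂mu0, F x ≤ C * G x) :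
    wnorm q w F ≤ C * wnorm q w G := by
  have hint : ∫⁻ x in Ioi (0 : ℝ), F x ^ q * w x ≤
      (C : ℝ≥0∞) ^ q * ∫⁻ x in Ioi (0 : ℝ), G x ^ q * w x := by
    rw [← lintegral_const_mul _ (by fun_prop)]
    refine lintegral_mono_ae (h.mono fun x hx => ?_)
    rw [← mul_assoc, ← ENNReal.mul_rpow_of_nonneg _ _ hq.le]
    gcongr
  calc wnorm q w F ≤ ((C : ℝ≥0∞) ^ q * ∫⁻ x in Ioi (0 : ℝ), G x ^ q * w x) ^ (1 / q) := by
        unfold wnorm; gcongr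
    _ = C * wnorm q w G := by
        rw [ENNReal.mul_rpow_of_nonneg _ _ (by positivity), ← ENNReal.rpow_mul,
          mul_one_div_cancel hq.ne', ENNReal.rpow_one, wnorm]

lemma wnorm_one (w f : ℝ → ℝ≥0∞) : wnorm 1 w f = ∫⁻ x in Ioi (0 : ℝ), f x * w x := by
  simp [wnorm]

theorem statement4 (q α : ℝ) (hq : 0 < q) (hα : 0 < α)
    (w v : ℝ → ℝ≥0∞) (hw : IsWeight w) (hv : IsWeight v)
    (T : (ℝ → ℝ≥0∞) → ℝ → ℝ≥0∞) (hT : IsMQL T) :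
    (∃ C : ℝ≥0, 0 < C ∧ ∀ f : ℝ → ℝ≥0∞, Measurable f → AntitoneOn f (Ioi (0 : ℝ)) →
        wnorm q w (T f) ≤ (C : ℝ≥0∞) * wnorm 1 v f) ↔
      (∃ C' : ℝ≥0, 0 < C' ∧ ∀ h : ℝ → ℝ≥0∞, Measurable h →
        wnorm q w (T fun x =>
            (∫⁻ t in Ioc (0 : ℝ) x, v t) ^ (-(α + 1)) *
              ∫⁻ t in Ioc (0 : ℝ) x, h t * (∫⁻ s in Ioc (0 : ℝ) t, v s) ^ α) ≤
          (C' : ℝ≥0∞) * ∫⁻ t in Ioi (0 : ℝ), h t) := by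
  obtain ⟨C₁, hC₁, hmono⟩ := hT.mono
  change _ ↔ ∃ C' : ℝ≥0, 0 < C' ∧ ∀ h : ℝ → ℝ≥0∞, Measurable h →
    wnorm q w (T (hardyAvg α v h)) ≤ (C' : ℝ≥0∞) * ∫⁻ t in Ioi (0 : ℝ), h t
  have hcompare : ∀ f g : ℝ → ℝ≥0∞, Measurable f → Measurable g →
      (∀ x ∈ Ioi (0 : ℝ), f x ≤ g x) → wnorm q w (T f) ≤ C₁ * wnorm q w (T g) :=
    fun f g hf hg hfg => wnorm_le_of_ae_le hq hw.1 (hT.measurable_map g hg) C₁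
      (hmono f g hf hg ((ae_restrict_mem measurableSet_Ioi).mono hfg))
  constructor
  · rintro ⟨C, hC, hbound⟩
    have hK := ENNReal.coe_toNNReal (kernelConst_ne_top hα)
    refine ⟨C₁ * C * ((kernelConst α).toNNReal + 1), by positivity, fun h hh => ?_⟩
    have hanti := hardyMajorant_antitone hα v h
    calc wnorm q w (T (hardyAvg α v h)) ≤ C₁ * wnorm q w (T (hardyMajorant α v h)) :=
          hcompare _ _ (measurable_hardyAvg α v h) hanti.measurable
            fun x _ => hardyAvg_le_hardyMajorant hh x
      _ ≤ C₁ * (C * wnorm 1 v (hardyMajorant α v h)) := by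
          gcongr; exact hbound _ hanti.measurable (hanti.antitoneOn _)
      _ ≤ C₁ * (C * ((kernelConst α + 1) * ∫⁻ t in Ioi (0 : ℝ), h t)) := by
          rw [wnorm_one]
          gcongr
          exact (lintegral_hardyMajorant_le hα hv.1 hh).trans (by gcongr; exact le_self_add)
      _ = _ := by push_cast; rw [hK]; ring
  · rintro ⟨C', hC', hbound⟩
    refine ⟨C₁ * C' * 2 ^ (α + 1), by positivity, fun f hf hanti => ?_⟩
    have hvm := hv.1
    have h2 : (((2 : ℝ≥0) ^ (α + 1) : ℝ≥0) : ℝ≥0∞) = 2 ^ (α + 1) := by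
      rw [ENNReal.coe_rpow_of_nonneg _ (by positivity), ENNReal.coe_ofNat]
    rcases eq_or_ne (∫⁻ t in Ioi (0 : ℝ), f t * v t) ∞ with htop | htop
    · rw [wnorm_one, htop, ENNReal.mul_top (ENNReal.coe_ne_zero.2 (by positivity))]
      exact le_top
    calc wnorm q w (T f)
        ≤ C₁ * wnorm q w (T (hardyAvg α v fun t => 2 ^ (α + 1) * (f t * v t))) :=
          hcompare _ _ hf (measurable_hardyAvg _ _ _) fun x hx => le_hardyAvg hα hv hanti htop hx
      _ ≤ C₁ * (C' * ∫⁻ t in Ioi (0 : ℝ), 2 ^ (α + 1) * (f t * v t)) := by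
          gcongr; exact hbound _ (by fun_prop)
      _ = _ := by
          rw [lintegral_const_mul _ (by fun_prop), wnorm_one]
          push_cast [h2]
          ring
end
end
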